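/- Let n ≥ 2, 1 ≤ p ≤ q ≤ ∞, 1 ≤ p̃ ≤ q̃ ≤ ∞, and let α, β be real numbers satisfying β > −n/q, α < n(1 − 1/p), and Λ(α,p,p̃) ≥ Λ(β,q,q̃). Let η ∈ ℕⁿ be a multi-index with |η| + n/p − n/q + α − β ≥ 0. Then there is a constant c_η, depending only on n, p, q, p̃, q̃, α, β, η, such that for every t > 0 and every measurable u₀ : ℝⁿ → ℝ one has ‖|x|^β ((∂^η G_t) ∗ u₀)‖_{L^q_{|x|}L^{q̃}_θ} ≤ c_η t^{−(|η| + n/p − n/q + α − β)/2} ‖|x|^α u₀‖_{L^p_{|x|}L^{p̃}_θ}. -/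

import Mathlib

open MeasureTheory ENNReal Metric Set Filter

noncomputable section

/-- The surface measure on the unit sphere `S^{n-1} ⊂ ℝⁿ`. -/
def sphereMeasure (n : ℕ) : Measure (sphere (0 : EuclideanSpace ℝ (Fin n)) 1) :=
  Measure.toSphere (volume : Measure (EuclideanSpace ℝ (Fin n)))

/-- The `L^{p̃}(S^{n-1})` norm of `θ ↦ f (ρ θ)`. -/
def angNorm (n : ℕ) (pt : ℝ≥0∞) (f : EuclideanSpace ℝ (Fin n) → ℝ) (ρ : ℝ) : ℝ≥0∞ :=
  eLpNorm (fun θ : sphere (0 : EuclideanSpace ℝ (Fin n)) 1 =>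
    f (ρ • (θ : EuclideanSpace ℝ (Fin n)))) pt (sphereMeasure n)

/-- The mixed radial-angular norm `‖f‖_{L^p_{|x|} L^{p̃}_θ}`. -/
def mixedNorm (n : ℕ) (p pt : ℝ≥0∞) (f : EuclideanSpace ℝ (Fin n) → ℝ) : ℝ≥0∞ :=
  if p = ∞ then ⨆ ρ ∈ Ioi (0 : ℝ), angNorm n pt f ρ
  else (∫⁻ ρ in Ioi (0 : ℝ),
      angNorm n pt f ρ ^ p.toReal * ENNReal.ofReal (ρ ^ (n - 1))) ^ (1 / p.toReal)

/-- Convolution on `ℝⁿ`. -/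
def conv (n : ℕ) (k f : EuclideanSpace ℝ (Fin n) → ℝ) (x : EuclideanSpace ℝ (Fin n)) : ℝ :=
  ∫ y, k (x - y) * f y

/-- The heat kernel `G_t(x) = (4πt)^{-n/2} e^{-|x|²/(4t)}`. -/
def heatKernel (n : ℕ) (t : ℝ) (x : EuclideanSpace ℝ (Fin n)) : ℝ :=
  (4 * Real.pi * t) ^ (-(n : ℝ) / 2) * Real.exp (-‖x‖ ^ 2 / (4 * t))

/-- Partial derivative in the `i`-th coordinate direction. -/
def pderiv' (n : ℕ) (i : Fin n) (f : EuclideanSpace ℝ (Fin n) → ℝ) :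
    EuclideanSpace ℝ (Fin n) → ℝ :=
  fun x => fderiv ℝ f x (EuclideanSpace.single i 1)

/-- Iterated partial derivative `∂^η` corresponding to a multi-index `η`. -/
def multiDeriv (n : ℕ) (η : Fin n → ℕ) (f : EuclideanSpace ℝ (Fin n) → ℝ) :
    EuclideanSpace ℝ (Fin n) → ℝ :=
  (List.finRange n).foldr (fun i g => (pderiv' n i)^[η i] g) f

/-- Dilation `(S_λ f)(x) = f (x/λ)`. -/
def dilate (n : ℕ) (l : ℝ) (f : EuclideanSpace ℝ (Fin n) → ℝ) :
    EuclideanSpace ℝ (Fin n) → ℝ :=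
  fun x => f (l⁻¹ • x)

section Schur

variable {X Y : Type*} [MeasurableSpace X] [MeasurableSpace Y] {μ : Measure X} {ν : Measure Y}

lemma eLpNorm_ennreal_rpow {p : ℝ≥0∞} (h0 : p ≠ 0) (ht : p ≠ ∞) (f : X → ℝ≥0∞) :
    eLpNorm f p μ ^ p.toReal = ∫⁻ x, f x ^ p.toReal ∂μ := by
  have hp : 0 < p.toReal := ENNReal.toReal_pos h0 ht
  rw [eLpNorm_eq_lintegral_rpow_enorm_toReal h0 ht, ← ENNReal.rpow_mul, one_div,
    inv_mul_cancel₀ hp.ne', ENNReal.rpow_one]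
  rfl

lemma toReal_ge_one {p : ℝ≥0∞} (hp : 1 ≤ p) (ht : p ≠ ∞) : 1 ≤ p.toReal := by
  simpa using ENNReal.toReal_mono ht hp

/-- Jensen's inequality for the measure with density `k`. -/
lemma lintegral_mul_rpow_le {k v : Y → ℝ≥0∞} (hk : Measurable k) (hv : Measurable v)
    {p : ℝ} (hp : 1 ≤ p) :
    (∫⁻ y, k y * v y ∂ν) ^ p ≤ (∫⁻ y, k y ∂ν) ^ (p - 1) * ∫⁻ y, k y * v y ^ p ∂ν := by
  have hp0 : 0 < p := by linarith
  have hpi : p⁻¹ ≤ 1 := inv_le_one_of_one_le₀ hp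
  have hpi0 : 0 ≤ p⁻¹ := by positivity
  have key := ENNReal.lintegral_mul_norm_pow_le (μ := ν) (f := k) (g := fun y => k y * v y ^ p)
    hk.aemeasurable (hk.mul (hv.pow_const p)).aemeasurable (p := 1 - p⁻¹) (q := p⁻¹)
    (by linarith) hpi0 (by ring)
  have e : ∀ y, k y ^ (1 - p⁻¹) * (k y * v y ^ p) ^ p⁻¹ = k y * v y := fun y => by
    rw [ENNReal.mul_rpow_of_nonneg _ _ hpi0, ← ENNReal.rpow_mul, mul_inv_cancel₀ hp0.ne',
      ENNReal.rpow_one, ← mul_assoc, ← ENNReal.rpow_add_of_nonneg _ _ (by linarith) hpi0]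
    simp
  simp only [e] at key
  calc _ ≤ _ := ENNReal.rpow_le_rpow key hp0.le
    _ = _ := by
      rw [ENNReal.mul_rpow_of_nonneg _ _ hp0.le, ← ENNReal.rpow_mul, ← ENNReal.rpow_mul,
        inv_mul_cancel₀ hp0.ne', ENNReal.rpow_one, sub_mul, inv_mul_cancel₀ hp0.ne', one_mul]

lemma inv_toReal_mul {p : ℝ≥0∞} (h0 : p ≠ 0) (ht : p ≠ ∞) : (p⁻¹).toReal * p.toReal = 1 := by
  rw [ENNReal.toReal_inv, inv_mul_cancel₀ (ENNReal.toReal_pos h0 ht).ne']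

lemma inv_toReal_le_one {p : ℝ≥0∞} (hp : 1 ≤ p) : (p⁻¹).toReal ≤ 1 := by
  have : p⁻¹ ≤ 1 := ENNReal.inv_le_one.2 hp
  simpa using ENNReal.toReal_mono ENNReal.one_ne_top this

lemma inv_toReal_anti {p q : ℝ≥0∞} (hp : 1 ≤ p) (hpq : p ≤ q) :
    (q⁻¹).toReal ≤ (p⁻¹).toReal :=
  ENNReal.toReal_mono (ENNReal.inv_ne_top.2 (zero_lt_one.trans_le hp).ne')
    (ENNReal.inv_le_inv.2 hpq)

/-- Pointwise bound for an integral against a kernel bounded by `1`. -/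
lemma lintegral_mul_le_eLpNorm {k v : Y → ℝ≥0∞} (hk : Measurable k) (hv : Measurable v)
    (hk1 : ∀ y, k y ≤ 1) {A : ℝ≥0∞} (hA : ∫⁻ y, k y ∂ν ≤ A) {p : ℝ≥0∞} (hp : 1 ≤ p) :
    ∫⁻ y, k y * v y ∂ν ≤ A ^ (1 - (p⁻¹).toReal) * eLpNorm v p ν := by
  by_cases ht : p = ∞
  · subst ht
    simp only [inv_top, toReal_zero, sub_zero, ENNReal.rpow_one]
    calc _ ≤ ∫⁻ y, k y * eLpNorm v ∞ ν ∂ν := by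
          refine lintegral_mono_ae ?_
          rw [eLpNorm_exponent_top]
          filter_upwards [ae_le_eLpNormEssSup (f := v) (μ := ν)] with y hy
          gcongr
          simpa using hy
      _ = (∫⁻ y, k y ∂ν) * eLpNorm v ∞ ν := lintegral_mul_const _ hk
      _ ≤ _ := by gcongr
  · have h0 : p ≠ 0 := (zero_lt_one.trans_le hp).ne'
    have h1 := toReal_ge_one hp ht
    have hp0 : 0 < p.toReal := by linarith
    rw [← ENNReal.rpow_le_rpow_iff hp0, ENNReal.mul_rpow_of_nonneg _ _ hp0.le,
      eLpNorm_ennreal_rpow h0 ht, ← ENNReal.rpow_mul, sub_mul, inv_toReal_mul h0 ht, one_mul]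
    refine (lintegral_mul_rpow_le hk hv h1).trans ?_
    gcongr with y
    exact mul_le_of_le_one_left zero_le (hk1 y)

variable [SFinite μ] [SFinite ν]

/-- **Schur test**, mapping `L^p` to `L^q` for `p ≤ q`, for a kernel bounded by `1`. -/
lemma eLpNorm_lintegral_mul_le {k : X → Y → ℝ≥0∞} {v : Y → ℝ≥0∞}
    (hk : Measurable (Function.uncurry k)) (hv : Measurable v)
    (hk1 : ∀ x y, k x y ≤ 1) {A : ℝ≥0∞} (hA : ∀ x, ∫⁻ y, k x y ∂ν ≤ A)
    (hA' : ∀ y, ∫⁻ x, k x y ∂μ ≤ A) {p q : ℝ≥0∞} (hp : 1 ≤ p) (hpq : p ≤ q) :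
    eLpNorm (fun x => ∫⁻ y, k x y * v y ∂ν) q μ
      ≤ A ^ (1 - ((p⁻¹).toReal - (q⁻¹).toReal)) * eLpNorm v p ν := by
  have hkx : ∀ x, Measurable (k x) := fun x => hk.comp measurable_prodMk_left
  have hpt : ∀ x, ∫⁻ y, k x y * v y ∂ν ≤ A ^ (1 - (p⁻¹).toReal) * eLpNorm v p ν :=
    fun x => lintegral_mul_le_eLpNorm (hkx x) hv (hk1 x) (hA x) hp
  by_cases htq : q = ∞
  · subst htq
    simp only [inv_top, toReal_zero, sub_zero]
    rw [eLpNorm_exponent_top]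
    exact essSup_le_of_ae_le _ (ae_of_all _ fun x => by simpa using hpt x)
  · have htp : p ≠ ∞ := fun h => htq (top_le_iff.1 (h ▸ hpq))
    have h0 : p ≠ 0 := (zero_lt_one.trans_le hp).ne'
    have h0q : q ≠ 0 := (zero_lt_one.trans_le (hp.trans hpq)).ne'
    have h1 := toReal_ge_one hp htp
    have hpq' : p.toReal ≤ q.toReal := ENNReal.toReal_mono htq hpq
    have hq0 : 0 < q.toReal := by linarith
    have hm : Measurable fun x => ∫⁻ y, k x y * v y ^ p.toReal ∂ν :=
      Measurable.lintegral_prod_right (hk.mul ((hv.pow_const _).comp measurable_snd))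
    have hLp : ∫⁻ x, (∫⁻ y, k x y * v y ∂ν) ^ p.toReal ∂μ
        ≤ A ^ p.toReal * ∫⁻ y, v y ^ p.toReal ∂ν := by
      calc _ ≤ ∫⁻ x, A ^ (p.toReal - 1) * ∫⁻ y, k x y * v y ^ p.toReal ∂ν ∂μ := by
            refine lintegral_mono fun x => (lintegral_mul_rpow_le (hkx x) hv h1).trans ?_
            gcongr
            exact hA x
        _ = A ^ (p.toReal - 1) * ∫⁻ y, v y ^ p.toReal * ∫⁻ x, k x y ∂μ ∂ν := by
            rw [lintegral_const_mul _ hm, lintegral_lintegral_swap]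
            · congr 1
              refine lintegral_congr fun y => ?_
              rw [lintegral_mul_const _ (show Measurable fun x => k x y from
                hk.comp measurable_prodMk_right), mul_comm]
            · exact (hk.mul ((hv.pow_const _).comp measurable_snd)).aemeasurable
        _ ≤ A ^ (p.toReal - 1) * ∫⁻ y, v y ^ p.toReal * A ∂ν := by
            gcongr with y
            exact hA' y
        _ = _ := by
            rw [lintegral_mul_const _ (hv.pow_const _), mul_comm _ A, ← mul_assoc]
            congr 1
            nth_rewrite 2 [← ENNReal.rpow_one A]
            rw [← ENNReal.rpow_add_of_nonneg _ _ (by linarith) zero_le_one]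
            congr 1; ring
    rw [← ENNReal.rpow_le_rpow_iff hq0, eLpNorm_ennreal_rpow h0q htq]
    set B := A ^ (1 - (p⁻¹).toReal) * eLpNorm v p ν with hB
    have hpi := inv_toReal_le_one hp
    calc _ ≤ ∫⁻ x, B ^ (q.toReal - p.toReal) * (∫⁻ y, k x y * v y ∂ν) ^ p.toReal ∂μ := by
          refine lintegral_mono fun x => ?_
          have : q.toReal = (q.toReal - p.toReal) + p.toReal := by ring
          conv_lhs => rw [this, ENNReal.rpow_add_of_nonneg _ _ (by linarith) (by linarith)]
          gcongr
          exact hpt x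
      _ = B ^ (q.toReal - p.toReal) * ∫⁻ x, (∫⁻ y, k x y * v y ∂ν) ^ p.toReal ∂μ :=
          lintegral_const_mul _ ((Measurable.lintegral_prod_right
            (hk.mul (hv.comp measurable_snd))).pow_const _)
      _ ≤ B ^ (q.toReal - p.toReal) * (A ^ p.toReal * eLpNorm v p ν ^ p.toReal) := by
          rw [eLpNorm_ennreal_rpow h0 htp]
          gcongr
      _ = _ := by
          rw [hB, ENNReal.mul_rpow_of_nonneg _ _ (by linarith),
            ENNReal.mul_rpow_of_nonneg _ _ hq0.le, ← ENNReal.rpow_mul, ← ENNReal.rpow_mul,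
            mul_mul_mul_comm, ← ENNReal.rpow_add_of_nonneg _ _
              (mul_nonneg (by linarith) (by linarith)) (by linarith),
            ← ENNReal.rpow_add_of_nonneg _ _ (by linarith) (by linarith)]
          congr 2
          · linear_combination inv_toReal_mul h0 htp - inv_toReal_mul h0q htq
          · ring

lemma measurable_eLpNorm_right {F : X → Y → ℝ≥0∞}
    (hF : Measurable (Function.uncurry F)) (p : ℝ≥0∞) :
    Measurable fun y => eLpNorm (fun x => F x y) p μ := by
  by_cases h0 : p = 0
  · simp [h0]
  by_cases ht : p = ∞
  · subst ht
    refine measurable_of_Ioi fun c => ?_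
    have : (fun y => eLpNorm (fun x => F x y) ∞ μ) ⁻¹' Ioi c
        = {y | μ ((fun x => (x, y)) ⁻¹' (Function.uncurry F ⁻¹' Ioi c)) = 0}ᶜ := by
      ext y
      simp only [eLpNorm_exponent_top, eLpNormEssSup_eq_essSup_enorm, mem_preimage, mem_Ioi,
        mem_compl_iff, mem_ofPred_eq, enorm_eq_self]
      rw [← not_le, not_iff_not]
      constructor
      · intro h
        have := (ENNReal.ae_le_essSup (μ := μ) (fun x => F x y))
        refine measure_mono_null (fun x hx => ?_) (ae_iff.1 this)
        simp only [mem_preimage, Function.uncurry_apply_pair, mem_Ioi, mem_ofPred_eq, not_le] at hx ⊢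
        exact h.trans_lt hx
      · intro h
        refine essSup_le_of_ae_le _ (ae_iff.2 ?_)
        simp only [not_le]
        exact h
    rw [this]
    exact (measurable_measure_prodMk_right (hF measurableSet_Ioi) (measurableSet_singleton 0)).compl
  · simp only [eLpNorm_eq_lintegral_rpow_enorm_toReal h0 ht, enorm_eq_self]
    exact ((hF.pow_const _).lintegral_prod_left').pow_const _

/-- **Minkowski's integral inequality** on a finite measure space. -/
lemma eLpNorm_lintegral_le [IsFiniteMeasure μ] {F : X → Y → ℝ≥0∞}
    (hF : Measurable (Function.uncurry F)) {p : ℝ≥0∞} (hp : 1 ≤ p) :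
    eLpNorm (fun x => ∫⁻ y, F x y ∂ν) p μ ≤ ∫⁻ y, eLpNorm (fun x => F x y) p μ ∂ν := by
  have hFx : ∀ y, Measurable fun x => F x y := fun y => hF.comp measurable_prodMk_right
  have hG : Measurable fun x => ∫⁻ y, F x y ∂ν := Measurable.lintegral_prod_right hF
  by_cases ht : p = ∞
  · subst ht
    rw [eLpNorm_exponent_top]
    refine essSup_le_of_ae_le _ ?_
    have h1 : ∀ᵐ y ∂ν, ∀ᵐ x ∂μ, F x y ≤ eLpNorm (fun x => F x y) ∞ μ := ae_of_all _ fun y => by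
      rw [eLpNorm_exponent_top]
      filter_upwards [ae_le_eLpNormEssSup (f := fun x => F x y) (μ := μ)] with x hx
      simpa using hx
    have h2 : ∀ᵐ x ∂μ, ∀ᵐ y ∂ν, F x y ≤ eLpNorm (fun x => F x y) ∞ μ := by
      rw [Measure.ae_ae_comm]
      · exact h1
      · exact measurableSet_le hF ((measurable_eLpNorm_right hF ∞).comp measurable_snd)
    filter_upwards [h2] with x hx
    simpa using lintegral_mono_ae hx
  · have h0 : p ≠ 0 := (zero_lt_one.trans_le hp).ne'
    have h1 := toReal_ge_one hp ht
    set r := p.toReal with hr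
    have hr0 : 0 < r := by linarith
    have hri : r⁻¹ ≤ 1 := inv_le_one_of_one_le₀ h1
    have hri0 : 0 ≤ r⁻¹ := by positivity
    set B := ∫⁻ y, eLpNorm (fun x => F x y) p μ ∂ν with hB
    have hGN : ∀ N : ℕ, Measurable fun x => min (∫⁻ y, F x y ∂ν) (N : ℝ≥0∞) :=
      fun N => hG.min measurable_const
    have hJ : ∀ N : ℕ, ∫⁻ x, (min (∫⁻ y, F x y ∂ν) (N : ℝ≥0∞)) ^ r ∂μ ≤ B ^ r := by
      intro N
      set g := fun x => min (∫⁻ y, F x y ∂ν) (N : ℝ≥0∞) with hg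
      have hgm : Measurable g := hGN N
      set J := ∫⁻ x, g x ^ r ∂μ with hJ
      have hJt : J ≠ ∞ := by
        have : J ≤ ∫⁻ _, (N : ℝ≥0∞) ^ r ∂μ := lintegral_mono fun x => by
          gcongr
          exact min_le_right _ _
        refine ne_top_of_le_ne_top ?_ this
        rw [lintegral_const]
        exact ENNReal.mul_ne_top (ENNReal.rpow_ne_top_of_nonneg hr0.le (ENNReal.natCast_ne_top N))
          (measure_ne_top _ _)
      have key : J ≤ B * J ^ (1 - r⁻¹) := by
        calc J ≤ ∫⁻ x, ∫⁻ y, F x y * g x ^ (r - 1) ∂ν ∂μ := by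
              refine lintegral_mono fun x => ?_
              rw [lintegral_mul_const _ (show Measurable fun y => F x y from
                hF.comp measurable_prodMk_left)]
              have : r = 1 + (r - 1) := by ring
              conv_lhs => rw [this, ENNReal.rpow_add_of_nonneg _ _ zero_le_one (by linarith),
                ENNReal.rpow_one]
              gcongr
              exact min_le_left _ _
          _ = ∫⁻ y, ∫⁻ x, F x y * g x ^ (r - 1) ∂μ ∂ν :=
              lintegral_lintegral_swap
                (hF.mul ((hgm.pow_const _).comp measurable_fst)).aemeasurable
          _ ≤ ∫⁻ y, eLpNorm (fun x => F x y) p μ * J ^ (1 - r⁻¹) ∂ν := by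
              refine lintegral_mono fun y => ?_
              have := ENNReal.lintegral_mul_norm_pow_le (μ := μ) (f := fun x => F x y ^ r)
                (g := fun x => g x ^ r) ((hFx y).pow_const r).aemeasurable
                (hgm.pow_const r).aemeasurable (p := r⁻¹) (q := 1 - r⁻¹) hri0
                (by linarith) (by ring)
              simp only [← ENNReal.rpow_mul] at this
              rw [mul_inv_cancel₀ hr0.ne', mul_sub, mul_inv_cancel₀ hr0.ne', mul_one] at this
              simp only [ENNReal.rpow_one] at this
              rw [eLpNorm_eq_lintegral_rpow_enorm_toReal h0 ht, one_div]
              exact this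
          _ = _ := lintegral_mul_const _ (measurable_eLpNorm_right hF p)
      by_cases hJ0 : J = 0
      · rw [hJ0]; exact zero_le
      have : J ^ r⁻¹ ≤ B := by
        have h2 : J ^ r⁻¹ * J ^ (1 - r⁻¹) ≤ B * J ^ (1 - r⁻¹) := by
          rw [← ENNReal.rpow_add _ _ hJ0 hJt]
          simpa using key
        exact (ENNReal.mul_le_mul_iff_left
          (ENNReal.rpow_pos (pos_iff_ne_zero.2 hJ0) hJt).ne'
          (ENNReal.rpow_ne_top_of_nonneg (by linarith) hJt)).1 h2
      calc J = (J ^ r⁻¹) ^ r := by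
            rw [← ENNReal.rpow_mul, inv_mul_cancel₀ hr0.ne', ENNReal.rpow_one]
        _ ≤ _ := by gcongr
    rw [← ENNReal.rpow_le_rpow_iff hr0, eLpNorm_ennreal_rpow h0 ht]
    have hsup : ∀ a : ℝ≥0∞, a ^ r = ⨆ N : ℕ, (min a (N : ℝ≥0∞)) ^ r := fun a => by
      have h3 : a = ⨆ N : ℕ, min a (N : ℝ≥0∞) := by
        rw [← inf_iSup_eq, ENNReal.iSup_natCast, inf_top_eq]
      conv_lhs => rw [h3]
      exact (ENNReal.orderIsoRpow r hr0).map_iSup _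
    rw [lintegral_congr fun x => hsup _, lintegral_iSup fun N => (hGN N).pow_const r]
    · exact iSup_le hJ
    · intro M N hMN x
      dsimp only
      gcongr

end Schur

lemma eLpNorm_mul_const_ennreal {X : Type*} [MeasurableSpace X] {μ : Measure X} {h : X → ℝ≥0∞}
    (hh : Measurable h) (S : ℝ≥0∞) {p : ℝ≥0∞} (h0 : p ≠ 0) :
    eLpNorm (fun x => h x * S) p μ = eLpNorm h p μ * S := by
  by_cases ht : p = ∞
  · subst ht
    simp only [eLpNorm_exponent_top, eLpNormEssSup_eq_essSup_enorm, enorm_eq_self, mul_comm _ S]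
    exact ENNReal.essSup_const_mul
  · have hp : 0 < p.toReal := ENNReal.toReal_pos h0 ht
    simp only [eLpNorm_eq_lintegral_rpow_enorm_toReal h0 ht, enorm_eq_self]
    simp only [ENNReal.mul_rpow_of_nonneg _ _ hp.le]
    rw [lintegral_mul_const _ (hh.pow_const _), ENNReal.mul_rpow_of_nonneg _ _ (by positivity),
      ← ENNReal.rpow_mul, mul_one_div_cancel hp.ne', ENNReal.rpow_one]

/-- The power `ρ ^ b` near the origin, cut off to `ρ < 1`. -/
def cutPow (b : ℝ) : ℝ → ℝ≥0∞ := (Iio 1).indicator fun ρ => ENNReal.ofReal (ρ ^ b)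

lemma measurable_cutPow (b : ℝ) : Measurable (cutPow b) := by
  unfold cutPow
  exact (by fun_prop : Measurable fun ρ : ℝ => ENNReal.ofReal (ρ ^ b)).indicator measurableSet_Iio

lemma lintegral_cutPow_ne_top {b : ℝ} (hb : -1 < b) :
    ∫⁻ ρ in Ioi 0, cutPow b ρ ≠ ∞ := by
  unfold cutPow
  rw [lintegral_indicator measurableSet_Iio, Measure.restrict_restrict measurableSet_Iio,
    inter_comm, Ioi_inter_Iio]
  exact ((intervalIntegral.integrableOn_Ioo_rpow_iff one_pos).2 hb).lintegral_lt_top.ne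

lemma cutPow_rpow {b r ρ : ℝ} (hr : 0 < r) (hρ : 0 < ρ) :
    cutPow b ρ ^ r = cutPow (b * r) ρ := by
  unfold cutPow
  by_cases h : ρ ∈ Iio (1 : ℝ)
  · rw [indicator_of_mem h, indicator_of_mem h, ENNReal.ofReal_rpow_of_pos (by positivity),
      ← Real.rpow_mul hρ.le]
  · rw [indicator_of_notMem h, indicator_of_notMem h, ENNReal.zero_rpow_of_pos hr]

lemma cutPow_zero_le (ρ : ℝ) : cutPow 0 ρ ≤ 1 := by
  unfold cutPow
  by_cases h : ρ ∈ Iio (1 : ℝ)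
  · rw [indicator_of_mem h]; simp
  · rw [indicator_of_notMem h]; simp

lemma eLpNorm_cutPow_ne_top {b : ℝ} {q : ℝ≥0∞} (hq : 1 ≤ q) (hqt : q ≠ ∞)
    (hb : -(q⁻¹).toReal < b) :
    eLpNorm (cutPow b) q (volume.restrict (Ioi 0)) ≠ ∞ := by
  have h0 : q ≠ 0 := (zero_lt_one.trans_le hq).ne'
  have hq0 : 0 < q.toReal := ENNReal.toReal_pos h0 hqt
  have h : eLpNorm (cutPow b) q (volume.restrict (Ioi 0)) ^ q.toReal ≠ ∞ := by
    rw [eLpNorm_ennreal_rpow h0 hqt, setLIntegral_congr_fun measurableSet_Ioi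
      (fun ρ hρ => cutPow_rpow hq0 hρ)]
    refine lintegral_cutPow_ne_top ?_
    nlinarith [inv_toReal_mul h0 hqt]
  intro h'
  rw [h', ENNReal.top_rpow_of_pos hq0] at h
  exact h rfl

lemma exists_lintegral_cutPow_mul_le {p : ℝ≥0∞} (hp : 1 ≤ p) {a : ℝ} (ha0 : 0 ≤ a)
    (ha : a < 1 - (p⁻¹).toReal ∨ a = 0) :
    ∃ C : ℝ≥0∞, C ≠ ∞ ∧ ∀ F : ℝ → ℝ≥0∞, Measurable F →
      ∫⁻ r in Ioi 0, cutPow (-a) r * F r ≤ C * eLpNorm F p (volume.restrict (Ioi 0)) := by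
  set e := 1 - (p⁻¹).toReal with he
  have he0 : 0 ≤ e := by have := inv_toReal_le_one hp; linarith
  have hlt : -1 < -(a / e) := by
    rcases ha with ha | ha
    · have : a / e < 1 := (div_lt_one (by linarith)).2 ha
      linarith
    · simp [ha]
  refine ⟨(∫⁻ r in Ioi 0, cutPow (-(a / e)) r) ^ e,
    ENNReal.rpow_ne_top_of_nonneg he0 (lintegral_cutPow_ne_top hlt), fun F hF => ?_⟩
  have hle : ∀ r ∈ Ioi (0 : ℝ), cutPow (-a) r ≤ cutPow (-(a / e)) r ^ e := fun r hr => by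
    rcases he0.eq_or_lt with h | h
    · have : a = 0 := by rcases ha with ha | ha <;> linarith
      rw [← h, ENNReal.rpow_zero, this, neg_zero]
      exact cutPow_zero_le r
    · rw [cutPow_rpow h hr, neg_mul, div_mul_cancel₀ _ h.ne']
  by_cases ht : p = ∞
  · subst ht
    have he1 : e = 1 := by simp [he]
    calc _ ≤ ∫⁻ r in Ioi 0, cutPow (-(a / e)) r * eLpNorm F ∞ (volume.restrict (Ioi 0)) := by
          refine lintegral_mono_ae ?_
          rw [eLpNorm_exponent_top]
          filter_upwards [ae_le_eLpNormEssSup (f := F) (μ := volume.restrict (Ioi 0)),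
            ae_restrict_mem measurableSet_Ioi] with r hr h0
          have := hle r h0
          rw [he1, ENNReal.rpow_one, ← he1] at this
          gcongr
          simpa using hr
      _ = _ := by rw [lintegral_mul_const _ (measurable_cutPow _), he1, ENNReal.rpow_one]
  · have h0 : p ≠ 0 := (zero_lt_one.trans_le hp).ne'
    have hp0 : 0 < p.toReal := ENNReal.toReal_pos h0 ht
    have hpi : (p⁻¹).toReal = p.toReal⁻¹ := ENNReal.toReal_inv p
    have key := ENNReal.lintegral_mul_norm_pow_le (μ := volume.restrict (Ioi 0))
      (f := cutPow (-(a / e))) (g := fun r => F r ^ p.toReal)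
      (measurable_cutPow _).aemeasurable (hF.pow_const _).aemeasurable he0
      (q := p.toReal⁻¹) (by positivity) (by rw [he, hpi]; ring)
    rw [eLpNorm_eq_lintegral_rpow_enorm_toReal h0 ht, one_div]
    refine (setLIntegral_mono' measurableSet_Ioi fun r hr => ?_).trans key
    rw [← ENNReal.rpow_mul, mul_inv_cancel₀ hp0.ne', ENNReal.rpow_one]
    gcongr
    exact hle r hr

/-- The quadratically decaying kernel on the line. -/
def lineKernel (s : ℝ) : ℝ≥0∞ := ENNReal.ofReal ((1 + |s|) ^ (-2 : ℝ))

lemma measurable_lineKernel : Measurable lineKernel := by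
  unfold lineKernel; fun_prop

lemma lineKernel_le_one (s : ℝ) : lineKernel s ≤ 1 := by
  unfold lineKernel
  rw [ENNReal.ofReal_le_one]
  exact Real.rpow_le_one_of_one_le_of_nonpos (by linarith [abs_nonneg s]) (by norm_num)

lemma lintegral_lineKernel_ne_top : ∫⁻ s, lineKernel s ≠ ∞ := by
  have := finite_integral_one_add_norm (E := ℝ) (μ := volume) (r := 2) (by simp)
  simpa [lineKernel] using this.ne

/-- Weighted Young inequality on the half line. -/
lemma exists_radial_bound {p q : ℝ≥0∞} (hp : 1 ≤ p) (hpq : p ≤ q) {a b : ℝ} (ha0 : 0 ≤ a)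
    (ha : a < 1 - (p⁻¹).toReal ∨ a = 0) (hb : -(q⁻¹).toReal < b ∨ b = 0) (hb0 : b ≤ 0) :
    ∃ C : ℝ≥0∞, C ≠ ∞ ∧ ∀ F : ℝ → ℝ≥0∞, Measurable F →
      eLpNorm (fun ρ => (1 + cutPow b ρ) *
          ∫⁻ r in Ioi 0, lineKernel (ρ - r) * ((1 + cutPow (-a) r) * F r)) q
          (volume.restrict (Ioi 0)) ≤ C * eLpNorm F p (volume.restrict (Ioi 0)) ∧
      (q = ∞ → ∀ ρ, (1 + cutPow b ρ) *
          ∫⁻ r in Ioi 0, lineKernel (ρ - r) * ((1 + cutPow (-a) r) * F r)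
          ≤ C * eLpNorm F p (volume.restrict (Ioi 0))) := by
  obtain ⟨D, hD, hDF⟩ := exists_lintegral_cutPow_mul_le hp ha0 ha
  set lam : Measure ℝ := volume.restrict (Ioi 0) with hlam
  set A := ∫⁻ s, lineKernel s with hA
  have hAt : A ≠ ∞ := lintegral_lineKernel_ne_top
  have h1p := inv_toReal_le_one hp
  have hqp := inv_toReal_anti hp hpq
  have hq1 : 1 ≤ q := hp.trans hpq
  have hq0 : q ≠ 0 := (zero_lt_one.trans_le hq1).ne'
  have hkm : Measurable (Function.uncurry fun ρ r : ℝ => lineKernel (ρ - r)) :=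
    measurable_lineKernel.comp (measurable_fst.sub measurable_snd)
  have hkr : ∀ ρ, ∫⁻ r, lineKernel (ρ - r) ∂lam ≤ A := fun ρ =>
    (setLIntegral_le_lintegral _ _).trans (lintegral_sub_left_eq_self lineKernel ρ).le
  have hkl : ∀ r, ∫⁻ ρ, lineKernel (ρ - r) ∂lam ≤ A := fun r =>
    (setLIntegral_le_lintegral _ _).trans (lintegral_sub_right_eq_self lineKernel r).le
  have hq1i := inv_toReal_le_one hq1
  have hqi0 : 0 ≤ (q⁻¹).toReal := ENNReal.toReal_nonneg
  -- the sup bound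
  set S1 := A ^ (1 - (p⁻¹).toReal) + D with hS1
  have hS1t : S1 ≠ ∞ :=
    ENNReal.add_ne_top.2 ⟨ENNReal.rpow_ne_top_of_nonneg (by linarith) hAt, hD⟩
  set S2 := A ^ (1 - ((p⁻¹).toReal - (q⁻¹).toReal)) + A ^ (q⁻¹).toReal * D with hS2
  have hS2t : S2 ≠ ∞ :=
    ENNReal.add_ne_top.2 ⟨ENNReal.rpow_ne_top_of_nonneg (by linarith) hAt,
      ENNReal.mul_ne_top (ENNReal.rpow_ne_top_of_nonneg hqi0 hAt) hD⟩
  have split : ∀ F : ℝ → ℝ≥0∞, Measurable F → ∀ ρ,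
      ∫⁻ r, lineKernel (ρ - r) * ((1 + cutPow (-a) r) * F r) ∂lam
      = ∫⁻ r, lineKernel (ρ - r) * F r ∂lam
        + ∫⁻ r, lineKernel (ρ - r) * (cutPow (-a) r * F r) ∂lam := fun F hF ρ => by
    rw [← lintegral_add_left]
    · refine lintegral_congr fun r => by ring
    · exact (hkm.comp measurable_prodMk_left).mul hF
  have hsup : ∀ F : ℝ → ℝ≥0∞, Measurable F → ∀ ρ,
      ∫⁻ r, lineKernel (ρ - r) * ((1 + cutPow (-a) r) * F r) ∂lam ≤ S1 * eLpNorm F p lam := by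
    intro F hF ρ
    rw [split F hF, hS1, add_mul]
    refine add_le_add (lintegral_mul_le_eLpNorm (hkm.comp measurable_prodMk_left) hF
      (fun _ => lineKernel_le_one _) (hkr ρ) hp) ?_
    refine (lintegral_mono fun r => ?_).trans (hDF F hF)
    exact mul_le_of_le_one_left zero_le (lineKernel_le_one _)
  have hnorm : ∀ F : ℝ → ℝ≥0∞, Measurable F →
      eLpNorm (fun ρ => ∫⁻ r, lineKernel (ρ - r) * ((1 + cutPow (-a) r) * F r) ∂lam) q lam
        ≤ S2 * eLpNorm F p lam := by
    intro F hF
    have hcF : Measurable fun r => cutPow (-a) r * F r := (measurable_cutPow _).mul hF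
    simp only [split F hF]
    refine (eLpNorm_add_le (Measurable.lintegral_prod_right
      (hkm.mul (hF.comp measurable_snd))).aestronglyMeasurable
      (Measurable.lintegral_prod_right
      (hkm.mul (hcF.comp measurable_snd))).aestronglyMeasurable hq1).trans ?_
    rw [hS2, add_mul]
    refine add_le_add (eLpNorm_lintegral_mul_le hkm hF (fun _ _ => lineKernel_le_one _)
      hkr hkl hp hpq) ?_
    refine (eLpNorm_lintegral_mul_le hkm hcF (fun _ _ => lineKernel_le_one _)
      hkr hkl le_rfl hq1).trans ?_
    rw [mul_assoc]
    have e : 1 - (((1 : ℝ≥0∞)⁻¹).toReal - (q⁻¹).toReal) = (q⁻¹).toReal := by simp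
    rw [e]
    refine mul_le_mul' le_rfl ?_
    rw [eLpNorm_one_eq_lintegral_enorm]
    exact hDF F hF
  have hTm : ∀ F : ℝ → ℝ≥0∞, Measurable F →
      Measurable fun ρ => ∫⁻ r, lineKernel (ρ - r) * ((1 + cutPow (-a) r) * F r) ∂lam :=
    fun F hF => Measurable.lintegral_prod_right (hkm.mul
      ((((measurable_cutPow _).const_add 1).mul hF).comp measurable_snd))
  by_cases hb' : b = 0
  · refine ⟨2 * S2 + 2 * S1, by finiteness, fun F hF => ⟨?_, fun _ ρ => ?_⟩⟩
    · calc _ ≤ eLpNorm (fun ρ => (∫⁻ r, lineKernel (ρ - r) *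
            ((1 + cutPow (-a) r) * F r) ∂lam) * 2) q lam := by
            refine eLpNorm_mono_enorm fun ρ => ?_
            simp only [enorm_eq_self]
            rw [mul_comm]
            gcongr
            calc 1 + cutPow b ρ ≤ 1 + 1 := by rw [hb']; gcongr; exact cutPow_zero_le ρ
              _ = 2 := by norm_num
        _ ≤ S2 * eLpNorm F p lam * 2 := by
            rw [eLpNorm_mul_const_ennreal (hTm F hF) _ hq0]
            gcongr
            exact hnorm F hF
        _ ≤ _ := by
            rw [mul_comm, ← mul_assoc]
            gcongr
            exact le_self_add
    · calc _ ≤ (1 + 1) * (S1 * eLpNorm F p lam) := by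
            rw [hb']
            gcongr
            · exact cutPow_zero_le ρ
            · exact hsup F hF ρ
        _ = 2 * S1 * eLpNorm F p lam := by rw [one_add_one_eq_two, mul_assoc]
        _ ≤ _ := by
            gcongr
            exact le_add_self
  · have hb1 : -(q⁻¹).toReal < b := hb.resolve_right hb'
    have hqt : q ≠ ∞ := by
      rintro rfl
      simp at hb1
      exact hb' (le_antisymm hb0 hb1.le)
    have hE := eLpNorm_cutPow_ne_top hq1 hqt hb1
    refine ⟨S2 + eLpNorm (cutPow b) q lam * S1, by finiteness,
      fun F hF => ⟨?_, fun h => absurd h hqt⟩⟩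
    have hTF := hTm F hF
    simp only [add_mul, one_mul]
    simp only [add_mul, one_mul] at hTF
    refine (eLpNorm_add_le hTF.aestronglyMeasurable
      ((measurable_cutPow b).mul hTF).aestronglyMeasurable hq1).trans ?_
    have h1 := hnorm F hF
    have h2 := hsup F hF
    simp only [add_mul, one_mul] at h1 h2
    refine add_le_add h1 ?_
    calc _ ≤ eLpNorm (fun ρ => cutPow b ρ * (S1 * eLpNorm F p lam)) q lam := by
          refine eLpNorm_mono_enorm fun ρ => ?_
          simp only [enorm_eq_self]
          exact mul_le_mul' le_rfl (h2 ρ)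
      _ = _ := by rw [eLpNorm_mul_const_ennreal (measurable_cutPow b) _ hq0, mul_assoc]

lemma measurable_ofReal_one_add_rpow {X : Type*} [MeasurableSpace X] {f : X → ℝ}
    (hf : Measurable f) (c : ℝ) : Measurable fun x => ENNReal.ofReal ((1 + f x) ^ c) := by
  fun_prop

instance (n : ℕ) : IsFiniteMeasure (sphereMeasure n) := by
  unfold sphereMeasure; infer_instance

lemma norm_smul_sphere {n : ℕ} {r : ℝ} (hr : 0 ≤ r)
    (ω : sphere (0 : EuclideanSpace ℝ (Fin n)) 1) :
    ‖r • (ω : EuclideanSpace ℝ (Fin n))‖ = r := by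
  rw [norm_smul, norm_eq_of_mem_sphere, mul_one, Real.norm_of_nonneg hr]

/-- Integration in polar coordinates. -/
lemma lintegral_polar {n : ℕ} (hn : 2 ≤ n) {F : EuclideanSpace ℝ (Fin n) → ℝ≥0∞}
    (hF : Measurable F) :
    ∫⁻ y, F y = ∫⁻ r in Ioi (0 : ℝ), ENNReal.ofReal (r ^ (n - 1)) *
      ∫⁻ ω : sphere (0 : EuclideanSpace ℝ (Fin n)) 1,
        F (r • (ω : EuclideanSpace ℝ (Fin n))) ∂(sphereMeasure n) := by
  have : Nonempty (Fin n) := ⟨⟨0, by omega⟩⟩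
  have hG : Measurable fun z : sphere (0 : EuclideanSpace ℝ (Fin n)) 1 × Ioi (0 : ℝ) =>
      F ((z.2 : ℝ) • (z.1 : EuclideanSpace ℝ (Fin n))) := by
    apply hF.comp
    fun_prop
  have hG' : Measurable fun r : Ioi (0 : ℝ) =>
      ∫⁻ ω : sphere (0 : EuclideanSpace ℝ (Fin n)) 1,
        F ((r : ℝ) • (ω : EuclideanSpace ℝ (Fin n))) ∂(sphereMeasure n) :=
    Measurable.lintegral_prod_left' hG
  have mp := (volume : Measure (EuclideanSpace ℝ (Fin n))).measurePreserving_homeomorphUnitSphereProd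
  rw [finrank_euclideanSpace_fin] at mp
  calc ∫⁻ y, F y = ∫⁻ y in {0}ᶜ, F y := by
        rw [Measure.restrict_eq_self_of_ae_mem]
        exact compl_mem_ae_iff.2 (measure_singleton 0)
    _ = ∫⁻ x : ({0}ᶜ : Set (EuclideanSpace ℝ (Fin n))), F x ∂(Measure.comap Subtype.val volume) :=
        (lintegral_subtype_comap (measurableSet_singleton 0).compl F).symm
    _ = ∫⁻ x : ({0}ᶜ : Set (EuclideanSpace ℝ (Fin n))),
          (fun z : sphere (0 : EuclideanSpace ℝ (Fin n)) 1 × Ioi (0 : ℝ) =>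
            F ((z.2 : ℝ) • (z.1 : EuclideanSpace ℝ (Fin n))))
            (homeomorphUnitSphereProd _ x) ∂(Measure.comap Subtype.val volume) := by
        refine lintegral_congr fun x => ?_
        have hx : ‖(x : EuclideanSpace ℝ (Fin n))‖ ≠ 0 := norm_ne_zero_iff.2 x.2
        simp [smul_smul, hx]
    _ = _ := by
        rw [mp.lintegral_comp hG, lintegral_prod_symm _ hG.aemeasurable]
        unfold Measure.volumeIoiPow
        refine (lintegral_withDensity_eq_lintegral_mul _ (by fun_prop) hG').trans ?_
        exact lintegral_subtype_comap (μ := volume) (s := Ioi (0 : ℝ)) measurableSet_Ioi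
          (fun r : ℝ => ENNReal.ofReal (r ^ (n - 1)) *
            ∫⁻ ω : sphere (0 : EuclideanSpace ℝ (Fin n)) 1,
              F (r • (ω : EuclideanSpace ℝ (Fin n))) ∂(sphereMeasure n))

/-- The spherical mean of a decaying kernel gains a factor `(1 + r) ^ (1 - n)`. -/
lemma exists_sphere_kernel_bound {n : ℕ} (hn : 2 ≤ n) :
    ∃ C : ℝ, 1 ≤ C ∧ ∀ (x : EuclideanSpace ℝ (Fin n)) (r : ℝ), 0 ≤ r →
      ∫⁻ ω : sphere (0 : EuclideanSpace ℝ (Fin n)) 1,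
        ENNReal.ofReal ((1 + ‖x - r • (ω : EuclideanSpace ℝ (Fin n))‖) ^ (-((n : ℝ) + 1)))
          ∂(sphereMeasure n) ≤ ENNReal.ofReal (C * (1 + r) ^ (-((n : ℝ) - 1))) := by
  set A := ∫⁻ y : EuclideanSpace ℝ (Fin n), ENNReal.ofReal ((1 + ‖y‖) ^ (-((n : ℝ) + 1))) with hA
  have hAt : A ≠ ∞ :=
    (finite_integral_one_add_norm (by rw [finrank_euclideanSpace_fin]; linarith)).ne
  refine ⟨3 ^ ((n : ℝ) + 1) * A.toReal + 1, by
    have := ENNReal.toReal_nonneg (a := A); nlinarith [Real.rpow_pos_of_pos (x := 3) (by norm_num)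
      ((n : ℝ) + 1), mul_nonneg (Real.rpow_pos_of_pos (x := 3) (by norm_num)
      ((n : ℝ) + 1)).le this], fun x r hr => ?_⟩
  set I : ℝ → ℝ≥0∞ := fun s => ∫⁻ ω : sphere (0 : EuclideanSpace ℝ (Fin n)) 1,
        ENNReal.ofReal ((1 + ‖x - s • (ω : EuclideanSpace ℝ (Fin n))‖) ^ (-((n : ℝ) + 1)))
          ∂(sphereMeasure n) with hI
  have hIs : ∀ s ∈ Ioc (r + 1) (r + 2), I r ≤ ENNReal.ofReal (3 ^ ((n : ℝ) + 1)) * I s := by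
    intro s hs
    rw [hI]
    dsimp only
    rw [← lintegral_const_mul _ (measurable_ofReal_one_add_rpow (by fun_prop) _)]
    refine lintegral_mono fun ω => ?_
    dsimp only
    rw [← ENNReal.ofReal_mul (by positivity)]
    refine ENNReal.ofReal_le_ofReal ?_
    have h1 : ‖x - s • (ω : EuclideanSpace ℝ (Fin n))‖
        ≤ ‖x - r • (ω : EuclideanSpace ℝ (Fin n))‖ + 2 := by
      have e : x - s • (ω : EuclideanSpace ℝ (Fin n))
          = (x - r • (ω : EuclideanSpace ℝ (Fin n)))
            - (s - r) • (ω : EuclideanSpace ℝ (Fin n)) := by rw [sub_smul]; abel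
      rw [e]
      refine (norm_sub_le _ _).trans ?_
      rw [norm_smul_sphere (by linarith [hs.1])]
      linarith [hs.2]
    set X := ‖x - r • (ω : EuclideanSpace ℝ (Fin n))‖ with hX
    set Z := ‖x - s • (ω : EuclideanSpace ℝ (Fin n))‖ with hZ
    have hX0 : 0 ≤ X := norm_nonneg _
    have hZ0 : 0 ≤ Z := norm_nonneg _
    calc (1 + X) ^ (-((n : ℝ) + 1)) ≤ ((1 + Z) / 3) ^ (-((n : ℝ) + 1)) :=
          Real.rpow_le_rpow_of_nonpos (by positivity) (by linarith) (by
            have : (0 : ℝ) ≤ n := Nat.cast_nonneg n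
            linarith)
      _ = _ := by
          rw [Real.div_rpow (by positivity) (by norm_num), Real.rpow_neg (x := 3) (by norm_num),
            div_inv_eq_mul, mul_comm]
  have hpow : ∀ s ∈ Ioc (r + 1) (r + 2),
      ENNReal.ofReal ((1 + r) ^ ((n : ℝ) - 1)) ≤ ENNReal.ofReal (s ^ (n - 1)) := by
    intro s hs
    refine ENNReal.ofReal_le_ofReal ?_
    have e : ((n : ℝ) - 1) = ((n - 1 : ℕ) : ℝ) := by
      rw [Nat.cast_sub (by omega)]; simp
    rw [e, Real.rpow_natCast]
    exact pow_le_pow_left₀ (by linarith) (by linarith [hs.1]) _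
  have key : ENNReal.ofReal ((1 + r) ^ ((n : ℝ) - 1)) * I r
      ≤ ENNReal.ofReal (3 ^ ((n : ℝ) + 1)) * A := by
    calc _ = ∫⁻ s in Ioc (r + 1) (r + 2), ENNReal.ofReal ((1 + r) ^ ((n : ℝ) - 1)) * I r := by
          rw [setLIntegral_const, Real.volume_Ioc]
          norm_num
      _ ≤ ∫⁻ s in Ioc (r + 1) (r + 2), ENNReal.ofReal (3 ^ ((n : ℝ) + 1)) *
            (ENNReal.ofReal (s ^ (n - 1)) * I s) := by
          refine setLIntegral_mono' measurableSet_Ioc fun s hs => ?_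
          rw [mul_left_comm]
          exact mul_le_mul' (hpow s hs) (hIs s hs)
      _ ≤ ∫⁻ s in Ioi 0, ENNReal.ofReal (3 ^ ((n : ℝ) + 1)) *
            (ENNReal.ofReal (s ^ (n - 1)) * I s) :=
          lintegral_mono_set fun s hs => by
            have := hs.1
            simp only [mem_Ioi]; linarith
      _ = ENNReal.ofReal (3 ^ ((n : ℝ) + 1)) * A := by
          rw [lintegral_const_mul']
          · congr 1
            rw [hA, ← lintegral_sub_left_eq_self _ x]
            exact (lintegral_polar hn (measurable_ofReal_one_add_rpow (f := fun y => ‖x - y‖)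
              (by fun_prop) _)).symm
          · exact ENNReal.ofReal_ne_top
  have hpos : 0 < (1 + r) ^ ((n : ℝ) - 1) := Real.rpow_pos_of_pos (by linarith) _
  rw [mul_comm (3 ^ ((n : ℝ) + 1) * A.toReal + 1), Real.rpow_neg (by linarith),
    ENNReal.ofReal_mul (by positivity), ENNReal.ofReal_inv_of_pos hpos]
  rw [mul_comm, ← ENNReal.le_div_iff_mul_le
    (Or.inl (ENNReal.ofReal_pos.2 hpos).ne') (Or.inl ENNReal.ofReal_ne_top)] at key
  refine key.trans ?_
  rw [div_eq_mul_inv, mul_comm]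
  gcongr
  rw [ENNReal.ofReal_add (by positivity) (by norm_num), ENNReal.ofReal_mul (by positivity),
    ENNReal.ofReal_toReal hAt]
  exact le_self_add

/-- Peetre's inequality. -/
lemma one_add_rpow_le {x y : ℝ} (hx : 0 ≤ x) (hy : 0 ≤ y) (c : ℝ) :
    (1 + x) ^ c ≤ (1 + y) ^ c * (1 + |x - y|) ^ |c| := by
  have h0 := abs_nonneg (x - y)
  have h1 : 1 + x ≤ (1 + y) * (1 + |x - y|) := by
    nlinarith [le_abs_self (x - y), mul_nonneg hy h0]
  have h2 : 1 + y ≤ (1 + x) * (1 + |x - y|) := by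
    nlinarith [neg_abs_le (x - y), mul_nonneg hx h0]
  rcases le_total 0 c with hc | hc
  · rw [abs_of_nonneg hc, ← Real.mul_rpow (by linarith) (by linarith)]
    exact Real.rpow_le_rpow (by linarith) h1 hc
  · rw [abs_of_nonpos hc, Real.rpow_neg (by linarith), ← Real.inv_rpow (by linarith),
      ← Real.mul_rpow (by linarith) (by positivity)]
    refine Real.rpow_le_rpow_of_nonpos (by positivity) ?_ hc
    rw [← div_eq_mul_inv, div_le_iff₀ (by linarith)]
    exact h2

/-- Smoothing of the decaying kernel on spheres, from `L^{pt}` to `L^{qt}`. -/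
lemma exists_angular_bound {n : ℕ} (hn : 2 ≤ n) {pt qt : ℝ≥0∞} (hpt : 1 ≤ pt) (hptqt : pt ≤ qt)
    (N : ℝ) (hN : 0 ≤ N) :
    ∃ C : ℝ, 1 ≤ C ∧ ∀ (ρ r : ℝ), 0 < ρ → 0 < r →
      ∀ v : sphere (0 : EuclideanSpace ℝ (Fin n)) 1 → ℝ≥0∞, Measurable v →
      eLpNorm (fun θ : sphere (0 : EuclideanSpace ℝ (Fin n)) 1 =>
        ∫⁻ ω : sphere (0 : EuclideanSpace ℝ (Fin n)) 1,
          ENNReal.ofReal ((1 + ‖ρ • (θ : EuclideanSpace ℝ (Fin n))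
            - r • (ω : EuclideanSpace ℝ (Fin n))‖) ^ (-(N + ((n : ℝ) - 1) + ((n : ℝ) + 1)))) * v ω
          ∂(sphereMeasure n)) qt (sphereMeasure n)
      ≤ ENNReal.ofReal (C * (1 + r) ^ (-(((n : ℝ) - 1) * (1 - ((pt⁻¹).toReal - (qt⁻¹).toReal))))
          * (1 + |ρ - r|) ^ (-N)) * eLpNorm v pt (sphereMeasure n) := by
  obtain ⟨C, hC, hCb⟩ := exists_sphere_kernel_bound hn
  have hn' : (1 : ℝ) ≤ (n : ℝ) - 1 := by
    have : (2 : ℝ) ≤ n := by exact_mod_cast hn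
    linarith
  set d := (pt⁻¹).toReal - (qt⁻¹).toReal with hd
  have hd0 : 0 ≤ d := by have := inv_toReal_anti hpt hptqt; linarith
  have hd1 : d ≤ 1 := by
    have := inv_toReal_le_one hpt
    have : 0 ≤ (qt⁻¹).toReal := ENNReal.toReal_nonneg
    linarith
  refine ⟨C, hC, fun ρ r hρ hr v hv => ?_⟩
  set k : sphere (0 : EuclideanSpace ℝ (Fin n)) 1 → sphere (0 : EuclideanSpace ℝ (Fin n)) 1 →
    ℝ≥0∞ := fun θ ω => ENNReal.ofReal ((1 + ‖ρ • (θ : EuclideanSpace ℝ (Fin n))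
            - r • (ω : EuclideanSpace ℝ (Fin n))‖) ^ (-((n : ℝ) + 1))) with hk
  have hkm : Measurable (Function.uncurry k) :=
    measurable_ofReal_one_add_rpow (f := fun z : sphere (0 : EuclideanSpace ℝ (Fin n)) 1 ×
      sphere (0 : EuclideanSpace ℝ (Fin n)) 1 =>
      ‖ρ • (z.1 : EuclideanSpace ℝ (Fin n)) - r • (z.2 : EuclideanSpace ℝ (Fin n))‖)
      (by fun_prop) (-((n : ℝ) + 1))
  have hD : 1 ≤ 1 + |ρ - r| := by linarith [abs_nonneg (ρ - r)]
  set A := C * ((1 + r) ^ (-((n : ℝ) - 1)) * (1 + |ρ - r|) ^ ((n : ℝ) - 1)) with hA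
  have hA0 : 0 ≤ A := by positivity
  have hk1 : ∀ θ ω, k θ ω ≤ 1 := fun θ ω => by
    rw [hk, ENNReal.ofReal_le_one]
    have := norm_nonneg (ρ • (θ : EuclideanSpace ℝ (Fin n)) - r • (ω : EuclideanSpace ℝ (Fin n)))
    exact Real.rpow_le_one_of_one_le_of_nonpos (by linarith) (by linarith)
  have hkr : ∀ θ, ∫⁻ ω, k θ ω ∂(sphereMeasure n) ≤ ENNReal.ofReal A := fun θ => by
    refine (hCb _ r hr.le).trans (ENNReal.ofReal_le_ofReal ?_)
    rw [hA]
    gcongr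
    exact le_mul_of_one_le_right (by positivity) (Real.one_le_rpow hD (by linarith))
  have hkl : ∀ ω, ∫⁻ θ, k θ ω ∂(sphereMeasure n) ≤ ENNReal.ofReal A := fun ω => by
    have := hCb (r • (ω : EuclideanSpace ℝ (Fin n))) ρ hρ.le
    simp only [hk]
    simp only [norm_sub_rev (r • (ω : EuclideanSpace ℝ (Fin n)))] at this
    refine this.trans (ENNReal.ofReal_le_ofReal ?_)
    rw [hA]
    gcongr
    have := one_add_rpow_le hρ.le hr.le (-((n : ℝ) - 1))
    rwa [abs_neg, abs_of_nonneg (a := (n : ℝ) - 1) (by linarith)] at this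
  have schur := eLpNorm_lintegral_mul_le hkm hv hk1 hkr hkl hpt hptqt
  rw [← hd] at schur
  have hTm : Measurable fun θ => ∫⁻ ω, k θ ω * v ω ∂(sphereMeasure n) :=
    Measurable.lintegral_prod_right (hkm.mul (hv.comp measurable_snd))
  have hqt0 : qt ≠ 0 := (zero_lt_one.trans_le (hpt.trans hptqt)).ne'
  calc _ ≤ eLpNorm (fun θ => (∫⁻ ω, k θ ω * v ω ∂(sphereMeasure n)) *
          ENNReal.ofReal ((1 + |ρ - r|) ^ (-(N + ((n : ℝ) - 1))))) qt (sphereMeasure n) := by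
        refine eLpNorm_mono_enorm fun θ => ?_
        simp only [enorm_eq_self]
        rw [← lintegral_mul_const' _ _ ENNReal.ofReal_ne_top]
        refine lintegral_mono fun ω => ?_
        dsimp only
        rw [mul_right_comm, hk, ← ENNReal.ofReal_mul (by positivity)]
        refine mul_le_mul' (ENNReal.ofReal_le_ofReal ?_) le_rfl
        set Z := ‖ρ • (θ : EuclideanSpace ℝ (Fin n)) - r • (ω : EuclideanSpace ℝ (Fin n))‖
        have hZ : |ρ - r| ≤ Z := by
          have := abs_norm_sub_norm_le (ρ • (θ : EuclideanSpace ℝ (Fin n)))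
            (r • (ω : EuclideanSpace ℝ (Fin n)))
          rwa [norm_smul_sphere hρ.le, norm_smul_sphere hr.le] at this
        have hZ0 : 0 ≤ Z := (abs_nonneg _).trans hZ
        calc (1 + Z) ^ (-(N + ((n : ℝ) - 1) + ((n : ℝ) + 1)))
            = (1 + Z) ^ (-((n : ℝ) + 1)) * (1 + Z) ^ (-(N + ((n : ℝ) - 1))) := by
              rw [← Real.rpow_add (by linarith)]
              congr 1
              ring
          _ ≤ _ := mul_le_mul_of_nonneg_left
              (Real.rpow_le_rpow_of_nonpos (by linarith) (by linarith) (by linarith))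
              (Real.rpow_nonneg (by linarith) _)
    _ = eLpNorm (fun θ => ∫⁻ ω, k θ ω * v ω ∂(sphereMeasure n)) qt (sphereMeasure n) *
          ENNReal.ofReal ((1 + |ρ - r|) ^ (-(N + ((n : ℝ) - 1)))) :=
        eLpNorm_mul_const_ennreal hTm _ hqt0
    _ ≤ ENNReal.ofReal A ^ (1 - d) * eLpNorm v pt (sphereMeasure n) *
          ENNReal.ofReal ((1 + |ρ - r|) ^ (-(N + ((n : ℝ) - 1)))) := by gcongr
    _ = ENNReal.ofReal (A ^ (1 - d) * (1 + |ρ - r|) ^ (-(N + ((n : ℝ) - 1)))) *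
          eLpNorm v pt (sphereMeasure n) := by
        rw [ENNReal.ofReal_rpow_of_nonneg hA0 (by linarith),
          ENNReal.ofReal_mul (p := A ^ (1 - d)) (by positivity)]
        ring
    _ ≤ _ := by
        refine mul_le_mul' (ENNReal.ofReal_le_ofReal ?_) le_rfl
        have h1 : A ^ (1 - d) ≤ C * (1 + r) ^ (-(((n : ℝ) - 1) * (1 - d)))
            * (1 + |ρ - r|) ^ ((n : ℝ) - 1) := by
          rw [hA, Real.mul_rpow (by positivity) (by positivity),
            Real.mul_rpow (by positivity) (by positivity), ← Real.rpow_mul (by positivity),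
            ← Real.rpow_mul (by positivity), ← mul_assoc, neg_mul]
          gcongr
          · calc C ^ (1 - d) ≤ C ^ (1 : ℝ) := Real.rpow_le_rpow_of_exponent_le hC (by linarith)
              _ = C := Real.rpow_one C
          · nlinarith
        calc _ ≤ C * (1 + r) ^ (-(((n : ℝ) - 1) * (1 - d))) * (1 + |ρ - r|) ^ ((n : ℝ) - 1)
              * (1 + |ρ - r|) ^ (-(N + ((n : ℝ) - 1))) :=
                mul_le_mul_of_nonneg_right h1 (by positivity)
          _ = _ := by
              rw [mul_assoc, ← Real.rpow_add (by positivity)]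
              congr 2
              ring

lemma angNorm_rpow_mul {n : ℕ} (pt : ℝ≥0∞) (α : ℝ) (f : EuclideanSpace ℝ (Fin n) → ℝ) {ρ : ℝ}
    (hρ : 0 < ρ) :
    angNorm n pt (fun x => ‖x‖ ^ α * f x) ρ = ENNReal.ofReal (ρ ^ α) * angNorm n pt f ρ := by
  unfold angNorm
  simp only [norm_smul_sphere hρ.le]
  have := eLpNorm_const_smul (ρ ^ α) (fun θ : sphere (0 : EuclideanSpace ℝ (Fin n)) 1 =>
    f (ρ • (θ : EuclideanSpace ℝ (Fin n)))) pt (sphereMeasure n)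
  rwa [Real.enorm_of_nonneg (by positivity)] at this

lemma measurable_angNorm {n : ℕ} (pt : ℝ≥0∞) {f : EuclideanSpace ℝ (Fin n) → ℝ}
    (hf : Measurable f) : Measurable (angNorm n pt f) := by
  have hm : Measurable (Function.uncurry
      fun (θ : sphere (0 : EuclideanSpace ℝ (Fin n)) 1) (ρ : ℝ) =>
        ‖f (ρ • (θ : EuclideanSpace ℝ (Fin n)))‖ₑ) := by
    refine (hf.comp ?_).enorm
    fun_prop
  have := measurable_eLpNorm_right (μ := sphereMeasure n) hm pt
  simp only [eLpNorm_enorm] at this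
  exact this

lemma ofReal_rpow_rpow {n : ℕ} {p : ℝ≥0∞} (hn : 2 ≤ n) (h0 : p ≠ 0) (ht : p ≠ ∞) {r : ℝ}
    (hr : 0 < r) :
    ENNReal.ofReal (r ^ (((n : ℝ) - 1) * (p⁻¹).toReal)) ^ p.toReal
      = ENNReal.ofReal (r ^ (n - 1)) := by
  have : (p⁻¹).toReal * p.toReal = 1 := inv_toReal_mul h0 ht
  rw [ENNReal.ofReal_rpow_of_pos (by positivity), ← Real.rpow_mul hr.le, mul_assoc, this, mul_one,
    ← Real.rpow_natCast, Nat.cast_sub (by omega), Nat.cast_one]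

lemma mixedNorm_eq_eLpNorm {n : ℕ} (hn : 2 ≤ n) {p : ℝ≥0∞} (h0 : p ≠ 0) (ht : p ≠ ∞) (pt : ℝ≥0∞)
    (f : EuclideanSpace ℝ (Fin n) → ℝ) :
    mixedNorm n p pt f = eLpNorm (fun r => angNorm n pt f r *
      ENNReal.ofReal (r ^ (((n : ℝ) - 1) * (p⁻¹).toReal))) p (volume.restrict (Ioi 0)) := by
  rw [mixedNorm, if_neg ht, eLpNorm_eq_lintegral_rpow_enorm_toReal h0 ht]
  congr 1
  refine setLIntegral_congr_fun measurableSet_Ioi fun r hr => ?_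
  simp only [enorm_eq_self]
  rw [ENNReal.mul_rpow_of_nonneg _ _ ENNReal.toReal_nonneg, ofReal_rpow_rpow hn h0 ht hr]

lemma eLpNorm_le_mixedNorm {n : ℕ} (hn : 2 ≤ n) {p : ℝ≥0∞} (h0 : p ≠ 0) (pt : ℝ≥0∞)
    (f : EuclideanSpace ℝ (Fin n) → ℝ) :
    eLpNorm (fun r => angNorm n pt f r *
      ENNReal.ofReal (r ^ (((n : ℝ) - 1) * (p⁻¹).toReal))) p (volume.restrict (Ioi 0))
      ≤ mixedNorm n p pt f := by
  by_cases ht : p = ∞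
  · subst ht
    rw [mixedNorm, if_pos rfl, eLpNorm_exponent_top]
    refine essSup_le_of_ae_le _ ?_
    filter_upwards [ae_restrict_mem measurableSet_Ioi] with r hr
    simp only [ENNReal.inv_top, ENNReal.toReal_zero, mul_zero, Real.rpow_zero, ENNReal.ofReal_one,
      mul_one, enorm_eq_self]
    exact le_iSup₂ (f := fun ρ (_ : ρ ∈ Ioi (0 : ℝ)) => angNorm n pt f ρ) r hr
  · exact (mixedNorm_eq_eLpNorm hn h0 ht pt f).ge

lemma angNorm_le_lintegral {n : ℕ} (hn : 2 ≤ n) {pt qt : ℝ≥0∞} (hpt : 1 ≤ pt) (hptqt : pt ≤ qt)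
    (N : ℝ) (hN : 0 ≤ N) :
    ∃ C : ℝ, 0 < C ∧ ∀ (f u : EuclideanSpace ℝ (Fin n) → ℝ), Measurable u →
      (∀ x, ‖f x‖ₑ ≤ ∫⁻ y, ENNReal.ofReal
        ((1 + ‖x - y‖) ^ (-(N + ((n : ℝ) - 1) + ((n : ℝ) + 1)))) * ‖u y‖ₑ) →
      ∀ ρ, 0 < ρ → angNorm n qt f ρ ≤ ∫⁻ r in Ioi (0 : ℝ), ENNReal.ofReal (r ^ (n - 1)) *
        (ENNReal.ofReal (C *
          (1 + r) ^ (-(((n : ℝ) - 1) * (1 - ((pt⁻¹).toReal - (qt⁻¹).toReal))))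
            * (1 + |ρ - r|) ^ (-N)) * angNorm n pt u r) := by
  obtain ⟨C, hC, hCb⟩ := exists_angular_bound hn hpt hptqt N hN
  refine ⟨C, by linarith, fun f u hu hfu ρ hρ => ?_⟩
  set M := N + ((n : ℝ) - 1) + ((n : ℝ) + 1) with hM
  have hqt0 : qt ≠ 0 := (zero_lt_one.trans_le (hpt.trans hptqt)).ne'
  have hker : Measurable fun z : (sphere (0 : EuclideanSpace ℝ (Fin n)) 1 × ℝ) ×
      sphere (0 : EuclideanSpace ℝ (Fin n)) 1 =>
      ENNReal.ofReal ((1 + ‖ρ • (z.1.1 : EuclideanSpace ℝ (Fin n))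
        - z.1.2 • (z.2 : EuclideanSpace ℝ (Fin n))‖) ^ (-M)) *
        ‖u (z.1.2 • (z.2 : EuclideanSpace ℝ (Fin n)))‖ₑ := by
    refine Measurable.mul ?_ (hu.comp ?_).enorm
    · exact measurable_ofReal_one_add_rpow (f := fun z : (sphere (0 : EuclideanSpace ℝ (Fin n)) 1 × ℝ)
        × sphere (0 : EuclideanSpace ℝ (Fin n)) 1 => ‖ρ • (z.1.1 : EuclideanSpace ℝ (Fin n))
        - z.1.2 • (z.2 : EuclideanSpace ℝ (Fin n))‖) (by fun_prop) (-M)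
    · fun_prop
  have hin : Measurable fun z : sphere (0 : EuclideanSpace ℝ (Fin n)) 1 × ℝ =>
      ∫⁻ ω : sphere (0 : EuclideanSpace ℝ (Fin n)) 1,
        ENNReal.ofReal ((1 + ‖ρ • (z.1 : EuclideanSpace ℝ (Fin n))
          - z.2 • (ω : EuclideanSpace ℝ (Fin n))‖) ^ (-M)) *
          ‖u (z.2 • (ω : EuclideanSpace ℝ (Fin n)))‖ₑ ∂(sphereMeasure n) :=
    Measurable.lintegral_prod_right hker
  calc angNorm n qt f ρ
      ≤ eLpNorm (fun θ : sphere (0 : EuclideanSpace ℝ (Fin n)) 1 =>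
          ∫⁻ r in Ioi (0 : ℝ), (∫⁻ ω : sphere (0 : EuclideanSpace ℝ (Fin n)) 1,
            ENNReal.ofReal ((1 + ‖ρ • (θ : EuclideanSpace ℝ (Fin n))
              - r • (ω : EuclideanSpace ℝ (Fin n))‖) ^ (-M)) *
              ‖u (r • (ω : EuclideanSpace ℝ (Fin n)))‖ₑ ∂(sphereMeasure n)) *
            ENNReal.ofReal (r ^ (n - 1))) qt (sphereMeasure n) := by
        refine eLpNorm_mono_enorm fun θ => ?_
        refine (hfu _).trans ?_
        rw [lintegral_polar hn (by
          refine Measurable.mul ?_ hu.enorm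
          exact measurable_ofReal_one_add_rpow
            (f := fun y => ‖ρ • (θ : EuclideanSpace ℝ (Fin n)) - y‖) (by fun_prop) (-M))]
        simp only [enorm_eq_self, mul_comm (ENNReal.ofReal (_ ^ (n - 1)))]
        exact le_rfl
    _ ≤ _ := by
        refine (eLpNorm_lintegral_le (μ := sphereMeasure n) (ν := volume.restrict (Ioi (0 : ℝ)))
          (F := fun (θ : sphere (0 : EuclideanSpace ℝ (Fin n)) 1) (r : ℝ) =>
            (∫⁻ ω : sphere (0 : EuclideanSpace ℝ (Fin n)) 1,
            ENNReal.ofReal ((1 + ‖ρ • (θ : EuclideanSpace ℝ (Fin n))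
              - r • (ω : EuclideanSpace ℝ (Fin n))‖) ^ (-M)) *
              ‖u (r • (ω : EuclideanSpace ℝ (Fin n)))‖ₑ ∂(sphereMeasure n)) *
            ENNReal.ofReal (r ^ (n - 1))) (hin.mul (by fun_prop)) (hpt.trans hptqt)).trans ?_
        refine setLIntegral_mono' measurableSet_Ioi fun r hr => ?_
        refine (eLpNorm_mul_const_ennreal
          (hin.comp (measurable_prodMk_right (y := r))) _ hqt0).trans_le ?_
        rw [mul_comm]
        refine mul_le_mul' le_rfl ?_
        have hv : Measurable fun ω : sphere (0 : EuclideanSpace ℝ (Fin n)) 1 =>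
            ‖u (r • (ω : EuclideanSpace ℝ (Fin n)))‖ₑ := (hu.comp (by fun_prop)).enorm
        have := hCb ρ r hρ hr _ hv
        rwa [eLpNorm_enorm] at this

lemma ofReal_rpow_le_cutPow {x : ℝ} (hx : 0 < x) (B : ℝ) :
    ENNReal.ofReal (x ^ B) ≤
      ENNReal.ofReal (2 ^ |B| * (1 + x) ^ B) * (1 + cutPow (min B 0) x) := by
  have h1 : (1 : ℝ) ≤ 2 ^ |B| := Real.one_le_rpow (by norm_num) (abs_nonneg B)
  rcases le_total 0 B with hB | hB
  · calc ENNReal.ofReal (x ^ B) ≤ ENNReal.ofReal (2 ^ |B| * (1 + x) ^ B) := by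
          refine ENNReal.ofReal_le_ofReal ?_
          calc x ^ B ≤ (1 + x) ^ B := Real.rpow_le_rpow hx.le (by linarith) hB
            _ ≤ _ := le_mul_of_one_le_left (by positivity) h1
      _ ≤ _ := le_mul_of_one_le_right zero_le le_self_add
  · rw [min_eq_left hB, abs_of_nonpos hB]
    have key : ∀ y : ℝ, 0 < y → 1 + x ≤ 2 * y → y ^ B ≤ 2 ^ (-B) * (1 + x) ^ B := by
      intro y hy h
      calc y ^ B = 2 ^ (-B) * (2 * y) ^ B := by
            rw [Real.mul_rpow (by norm_num) hy.le, ← mul_assoc, ← Real.rpow_add (by norm_num)]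
            simp
        _ ≤ _ := by
            gcongr ?_ * ?_
            exact Real.rpow_le_rpow_of_nonpos (by linarith) h hB
    by_cases h : x < 1
    · have hc : cutPow B x = ENNReal.ofReal (x ^ B) := by
        unfold cutPow
        rw [indicator_of_mem (mem_Iio.2 h)]
      rw [hc]
      have h2 := key 1 one_pos (by linarith)
      rw [Real.one_rpow] at h2
      calc ENNReal.ofReal (x ^ B) ≤ 1 + ENNReal.ofReal (x ^ B) := le_add_self
        _ ≤ _ := le_mul_of_one_le_left zero_le (ENNReal.one_le_ofReal.2 h2)
    · refine (ENNReal.ofReal_le_ofReal (key x hx (by linarith))).trans ?_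
      exact le_mul_of_one_le_right zero_le le_self_add

lemma exists_weight_bound {n : ℕ} (hn : 2 ≤ n) {α B a0 e d : ℝ} (C : ℝ) (hC : 0 ≤ C)
    (hα : ((n : ℝ) - 1) + (-α - e) = -a0)
    (h : B - a0 - ((n : ℝ) - 1) * (1 - d) ≤ 0) (ρ r : ℝ) (hρ : 0 < ρ) (hr : 0 < r) :
    ENNReal.ofReal (ρ ^ B) * (ENNReal.ofReal (r ^ (n - 1)) *
        (ENNReal.ofReal (C * (1 + r) ^ (-(((n : ℝ) - 1) * (1 - d)))
          * (1 + |ρ - r|) ^ (-(|B| + 2))) * ENNReal.ofReal (r ^ (-α - e))))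
      ≤ ENNReal.ofReal (2 ^ |B| * 2 ^ |a0| * C) * (1 + cutPow (min B 0) ρ) *
        (lineKernel (ρ - r) * (1 + cutPow (-(max a0 0)) r)) := by
  have hD : (0 : ℝ) < 1 + |ρ - r| := by linarith [abs_nonneg (ρ - r)]
  have e1 : ENNReal.ofReal (r ^ (n - 1)) * ENNReal.ofReal (r ^ (-α - e))
      = ENNReal.ofReal (r ^ (-a0)) := by
    rw [← ENNReal.ofReal_mul (by positivity), ← Real.rpow_natCast, ← Real.rpow_add hr,
      Nat.cast_sub (by omega), Nat.cast_one, hα]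
  have h1 := ofReal_rpow_le_cutPow hρ B
  have h2 := ofReal_rpow_le_cutPow hr (-a0)
  have hmin : min (-a0) 0 = -(max a0 0) := by
    rw [← neg_zero, min_neg_neg, neg_zero]
  rw [hmin, abs_neg] at h2
  have h3 : (2 ^ |B| * (1 + ρ) ^ B) * (2 ^ |a0| * (1 + r) ^ (-a0)) *
      (C * (1 + r) ^ (-(((n : ℝ) - 1) * (1 - d))) * (1 + |ρ - r|) ^ (-(|B| + 2)))
      ≤ 2 ^ |B| * 2 ^ |a0| * C * (1 + |ρ - r|) ^ (-2 : ℝ) := by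
    have hr1 : (0 : ℝ) < 1 + r := by linarith
    calc _ = 2 ^ |B| * 2 ^ |a0| * C * ((1 + ρ) ^ B * ((1 + r) ^ (-a0)
            * (1 + r) ^ (-(((n : ℝ) - 1) * (1 - d)))) * (1 + |ρ - r|) ^ (-(|B| + 2))) := by ring
      _ ≤ 2 ^ |B| * 2 ^ |a0| * C * (((1 + r) ^ B * (1 + |ρ - r|) ^ |B|) * ((1 + r) ^ (-a0)
            * (1 + r) ^ (-(((n : ℝ) - 1) * (1 - d)))) * (1 + |ρ - r|) ^ (-(|B| + 2))) := by
          gcongr ?_ * (?_ * ?_ * ?_)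
          exact one_add_rpow_le hρ.le hr.le B
      _ = 2 ^ |B| * 2 ^ |a0| * C * ((1 + r) ^ (B - a0 - ((n : ℝ) - 1) * (1 - d))
            * (1 + |ρ - r|) ^ (-2 : ℝ)) := by
          rw [show B - a0 - ((n : ℝ) - 1) * (1 - d) = B + (-a0 + -(((n : ℝ) - 1) * (1 - d))) by ring,
            show (-2 : ℝ) = |B| + -(|B| + 2) by ring, Real.rpow_add hr1, Real.rpow_add hr1,
            Real.rpow_add hD]
          ring
      _ ≤ 2 ^ |B| * 2 ^ |a0| * C * (1 * (1 + |ρ - r|) ^ (-2 : ℝ)) := by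
          gcongr
          exact Real.rpow_le_one_of_one_le_of_nonpos (by linarith) h
      _ = _ := by rw [one_mul]
  calc _ = ENNReal.ofReal (ρ ^ B) * ENNReal.ofReal (r ^ (-a0)) *
        ENNReal.ofReal (C * (1 + r) ^ (-(((n : ℝ) - 1) * (1 - d)))
          * (1 + |ρ - r|) ^ (-(|B| + 2))) := by rw [← e1]; ring
    _ ≤ (ENNReal.ofReal (2 ^ |B| * (1 + ρ) ^ B) * (1 + cutPow (min B 0) ρ)) *
        (ENNReal.ofReal (2 ^ |a0| * (1 + r) ^ (-a0)) * (1 + cutPow (-(max a0 0)) r)) *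
        ENNReal.ofReal (C * (1 + r) ^ (-(((n : ℝ) - 1) * (1 - d)))
          * (1 + |ρ - r|) ^ (-(|B| + 2))) := by gcongr
    _ = ENNReal.ofReal ((2 ^ |B| * (1 + ρ) ^ B) * (2 ^ |a0| * (1 + r) ^ (-a0)) *
      (C * (1 + r) ^ (-(((n : ℝ) - 1) * (1 - d))) * (1 + |ρ - r|) ^ (-(|B| + 2)))) *
        ((1 + cutPow (min B 0) ρ) * (1 + cutPow (-(max a0 0)) r)) := by
        rw [ENNReal.ofReal_mul (p := 2 ^ |B| * (1 + ρ) ^ B * _) (by positivity),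
          ENNReal.ofReal_mul (p := 2 ^ |B| * (1 + ρ) ^ B) (by positivity)]
        ring
    _ ≤ ENNReal.ofReal (2 ^ |B| * 2 ^ |a0| * C * (1 + |ρ - r|) ^ (-2 : ℝ)) *
        ((1 + cutPow (min B 0) ρ) * (1 + cutPow (-(max a0 0)) r)) := by gcongr
    _ = _ := by
        rw [ENNReal.ofReal_mul (by positivity), lineKernel]
        ring

/-- Weighted mixed-norm bound for operators dominated by a rapidly decaying convolution. -/
lemma exists_mixedNorm_bound {n : ℕ} (hn : 2 ≤ n) {p q pt qt : ℝ≥0∞}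
    (hp : 1 ≤ p) (hpq : p ≤ q) (hpt : 1 ≤ pt) (hptqt : pt ≤ qt) {α β : ℝ}
    (hβ : -((n : ℝ) * (q⁻¹).toReal) < β)
    (hα : α < (n : ℝ) * (1 - (p⁻¹).toReal))
    (hΛ : β + ((n : ℝ) - 1) * (q⁻¹).toReal - ((n : ℝ) - 1) * (qt⁻¹).toReal
        ≤ α + ((n : ℝ) - 1) * (p⁻¹).toReal - ((n : ℝ) - 1) * (pt⁻¹).toReal) :
    ∃ (M : ℝ) (C : ℝ≥0∞), C ≠ ∞ ∧ ∀ f u : EuclideanSpace ℝ (Fin n) → ℝ, Measurable u →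
      (∀ x, ‖f x‖ₑ ≤ ∫⁻ y, ENNReal.ofReal ((1 + ‖x - y‖) ^ (-M)) * ‖u y‖ₑ) →
      mixedNorm n q qt (fun x => ‖x‖ ^ β * f x)
        ≤ C * mixedNorm n p pt (fun x => ‖x‖ ^ α * u x) := by
  have hp0 : p ≠ 0 := (zero_lt_one.trans_le hp).ne'
  have hq0 : q ≠ 0 := (zero_lt_one.trans_le (hp.trans hpq)).ne'
  set B := β + ((n : ℝ) - 1) * (q⁻¹).toReal with hB
  set a0 := α - ((n : ℝ) - 1) * (1 - (p⁻¹).toReal) with ha0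
  set e := ((n : ℝ) - 1) * (p⁻¹).toReal with he
  set d := (pt⁻¹).toReal - (qt⁻¹).toReal with hd
  obtain ⟨C1, hC1, hang⟩ := angNorm_le_lintegral hn hpt hptqt (|B| + 2) (by positivity)
  obtain ⟨C2, hC2, hrad⟩ := exists_radial_bound hp hpq (a := max a0 0) (b := min B 0)
    (le_max_right _ _)
    (by
      rcases le_total a0 0 with h | h
      · exact Or.inr (max_eq_right h)
      · left; rw [max_eq_left h]; linarith)
    (by
      rcases le_total B 0 with h | h
      · left; rw [min_eq_left h]; linarith
      · exact Or.inr (min_eq_right h)) (min_le_right _ _)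
  set K := ENNReal.ofReal (2 ^ |B| * 2 ^ |a0| * C1) with hK
  refine ⟨|B| + 2 + ((n : ℝ) - 1) + ((n : ℝ) + 1), K * C2, ENNReal.mul_ne_top ENNReal.ofReal_ne_top hC2, fun f u hu hfu => ?_⟩
  set w := fun x : EuclideanSpace ℝ (Fin n) => ‖x‖ ^ α * u x with hw
  have hwm : Measurable w := by rw [hw]; fun_prop
  set F : ℝ → ℝ≥0∞ := fun r => angNorm n pt w r * ENNReal.ofReal (r ^ e) with hF
  have hFm : Measurable F := (measurable_angNorm pt hwm).mul (by fun_prop)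
  have huF : ∀ r, 0 < r → angNorm n pt u r = ENNReal.ofReal (r ^ (-α - e)) * F r := by
    intro r hr
    simp only [hF, hw]
    rw [angNorm_rpow_mul pt α u hr, mul_comm (_ * _) (ENNReal.ofReal (r ^ e)), ← mul_assoc,
      ← mul_assoc, ← ENNReal.ofReal_mul (by positivity), ← ENNReal.ofReal_mul (by positivity),
      ← Real.rpow_add hr, ← Real.rpow_add hr]
    simp
  set T : ℝ → ℝ≥0∞ := fun ρ => (1 + cutPow (min B 0) ρ) *
    ∫⁻ r in Ioi 0, lineKernel (ρ - r) * ((1 + cutPow (-(max a0 0)) r) * F r) with hT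
  have hTpt : ∀ ρ, 0 < ρ → ENNReal.ofReal (ρ ^ B) * angNorm n qt f ρ ≤ K * T ρ := by
    intro ρ hρ
    calc _ ≤ ENNReal.ofReal (ρ ^ B) * ∫⁻ r in Ioi (0 : ℝ), ENNReal.ofReal (r ^ (n - 1)) *
        (ENNReal.ofReal (C1 * (1 + r) ^ (-(((n : ℝ) - 1) * (1 - d)))
            * (1 + |ρ - r|) ^ (-(|B| + 2))) * angNorm n pt u r) := by
          gcongr
          exact hang f u hu hfu ρ hρ
      _ = ∫⁻ r in Ioi (0 : ℝ), ENNReal.ofReal (ρ ^ B) * (ENNReal.ofReal (r ^ (n - 1)) *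
        (ENNReal.ofReal (C1 * (1 + r) ^ (-(((n : ℝ) - 1) * (1 - d)))
            * (1 + |ρ - r|) ^ (-(|B| + 2))) * angNorm n pt u r)) :=
          (lintegral_const_mul' _ _ ENNReal.ofReal_ne_top).symm
      _ ≤ ∫⁻ r in Ioi (0 : ℝ), (K * (1 + cutPow (min B 0) ρ)) *
            (lineKernel (ρ - r) * ((1 + cutPow (-(max a0 0)) r) * F r)) := by
          refine setLIntegral_mono' measurableSet_Ioi fun r hr => ?_
          rw [huF r hr]
          have := mul_le_mul_left (exists_weight_bound hn C1 hC1.le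
            (α := α) (B := B) (a0 := a0) (e := e) (d := d) (by rw [ha0, he]; ring)
            (by rw [hB, ha0, hd]; linarith) ρ r hρ hr) (F r)
          calc _ = _ := by ring
            _ ≤ _ := this
            _ = _ := by ring
      _ = _ := by
          rw [lintegral_const_mul, hT, mul_assoc]
          exact (measurable_lineKernel.comp (by fun_prop)).mul
            ((measurable_const.add (measurable_cutPow _)).mul hFm)
  have hG : ∀ ρ, 0 < ρ → angNorm n qt (fun x => ‖x‖ ^ β * f x) ρ *
      ENNReal.ofReal (ρ ^ (((n : ℝ) - 1) * (q⁻¹).toReal)) ≤ K * T ρ := by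
    intro ρ hρ
    rw [angNorm_rpow_mul qt β f hρ, mul_right_comm, ← ENNReal.ofReal_mul (by positivity),
      ← Real.rpow_add hρ]
    exact hTpt ρ hρ
  have hFle : eLpNorm F p (volume.restrict (Ioi 0)) ≤ mixedNorm n p pt w :=
    eLpNorm_le_mixedNorm hn hp0 pt w
  obtain ⟨hr1, hr2⟩ := hrad F hFm
  by_cases hqt : q = ∞
  · rw [mixedNorm, if_pos hqt]
    refine iSup₂_le fun ρ hρ => ?_
    have := hG ρ hρ
    rw [hqt] at this
    simp only [ENNReal.inv_top, ENNReal.toReal_zero, mul_zero, Real.rpow_zero, ENNReal.ofReal_one,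
      mul_one] at this
    refine this.trans ?_
    rw [mul_assoc]
    exact mul_le_mul' le_rfl ((hr2 hqt ρ).trans (mul_le_mul' le_rfl hFle))
  · rw [mixedNorm_eq_eLpNorm hn hq0 hqt]
    have hTm : Measurable T := by
      refine (measurable_const.add (measurable_cutPow _)).mul (Measurable.lintegral_prod_right ?_)
      exact (measurable_lineKernel.comp (by fun_prop)).mul
        (((measurable_const.add (measurable_cutPow _)).mul hFm).comp measurable_snd)
    calc _ ≤ eLpNorm (fun ρ => T ρ * K) q (volume.restrict (Ioi 0)) := by
          refine eLpNorm_mono_enorm_ae ?_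
          filter_upwards [ae_restrict_mem measurableSet_Ioi] with ρ hρ
          rw [mul_comm (T ρ)]
          exact hG ρ hρ
      _ = K * eLpNorm T q (volume.restrict (Ioi 0)) := by
          rw [eLpNorm_mul_const_ennreal hTm _ hq0, mul_comm]
      _ ≤ K * (C2 * mixedNorm n p pt w) :=
          mul_le_mul' le_rfl (hr1.trans (mul_le_mul' le_rfl hFle))
      _ = _ := by rw [mul_assoc]

/-- Polynomials times the heat kernel at time one. -/
inductive GaussPoly (n : ℕ) : (EuclideanSpace ℝ (Fin n) → ℝ) → Prop
  | base : GaussPoly n (heatKernel n 1)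
  | add {f g : EuclideanSpace ℝ (Fin n) → ℝ} :
      GaussPoly n f → GaussPoly n g → GaussPoly n (fun x => f x + g x)
  | coord {f : EuclideanSpace ℝ (Fin n) → ℝ} (i : Fin n) :
      GaussPoly n f → GaussPoly n (fun x => x i * f x)
  | const_mul {f : EuclideanSpace ℝ (Fin n) → ℝ} (c : ℝ) :
      GaussPoly n f → GaussPoly n (fun x => c * f x)

lemma hasFDerivAt_heatKernel_one (n : ℕ) (x : EuclideanSpace ℝ (Fin n)) :
    HasFDerivAt (heatKernel n 1) ((-(1 / 2) * heatKernel n 1 x) • innerSL ℝ x) x := by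
  have h1 : HasFDerivAt (fun y : EuclideanSpace ℝ (Fin n) => -‖y‖ ^ 2 / (4 * 1))
      ((-(1 / 2) : ℝ) • innerSL ℝ x) x := by
    have := ((hasStrictFDerivAt_norm_sq x).hasFDerivAt).const_mul (-(1 / 4) : ℝ)
    rw [show (fun y : EuclideanSpace ℝ (Fin n) => -‖y‖ ^ 2 / (4 * 1))
      = fun y => -(1 / 4) * ‖y‖ ^ 2 by ext y; ring]
    refine this.congr_fderiv ?_
    rw [← Nat.cast_smul_eq_nsmul ℝ, smul_smul]
    norm_num
  refine ((h1.exp).const_mul ((4 * Real.pi * 1) ^ (-(n : ℝ) / 2))).congr_fderiv ?_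
  rw [smul_smul, smul_smul, heatKernel]
  congr 1
  ring

lemma coord_hasFDerivAt {n : ℕ} (i : Fin n) (x : EuclideanSpace ℝ (Fin n)) :
    HasFDerivAt (fun y : EuclideanSpace ℝ (Fin n) => y i)
      (EuclideanSpace.proj i : EuclideanSpace ℝ (Fin n) →L[ℝ] ℝ) x :=
  (EuclideanSpace.proj i : EuclideanSpace ℝ (Fin n) →L[ℝ] ℝ).hasFDerivAt

lemma GaussPoly.differentiable {n : ℕ} {f : EuclideanSpace ℝ (Fin n) → ℝ} (hf : GaussPoly n f) :
    Differentiable ℝ f := by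
  induction hf with
  | base => exact fun x => (hasFDerivAt_heatKernel_one n x).differentiableAt
  | add _ _ h1 h2 => exact h1.add h2
  | coord i _ h =>
      exact Differentiable.mul (fun x => (coord_hasFDerivAt i x).differentiableAt) h
  | const_mul c _ h => exact h.const_mul c

lemma GaussPoly.pderiv {n : ℕ} {f : EuclideanSpace ℝ (Fin n) → ℝ} (hf : GaussPoly n f)
    (j : Fin n) : GaussPoly n (pderiv' n j f) := by
  induction hf with
  | base =>
      have : pderiv' n j (heatKernel n 1) = fun x => -(1 / 2) * (x j * heatKernel n 1 x) := by
        ext x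
        rw [pderiv', (hasFDerivAt_heatKernel_one n x).fderiv]
        simp [EuclideanSpace.inner_single_right]
        ring
      rw [this]
      exact (GaussPoly.base.coord j).const_mul _
  | @add f g hf hg h1 h2 =>
      have : pderiv' n j (fun x => f x + g x) = fun x => pderiv' n j f x + pderiv' n j g x := by
        ext x
        simp only [pderiv']
        rw [fderiv_fun_add (hf.differentiable x) (hg.differentiable x)]
        rfl
      rw [this]
      exact h1.add h2
  | @coord f i hf h =>
      have : pderiv' n j (fun x => x i * f x) =
          fun x => x i * pderiv' n j f x + (EuclideanSpace.single j (1 : ℝ) : EuclideanSpace ℝ (Fin n)) i * f x := by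
        ext x
        simp only [pderiv']
        rw [((coord_hasFDerivAt i x).fun_mul (hf.differentiable x).hasFDerivAt).fderiv]
        simp [mul_comm]
      rw [this]
      exact (h.coord i).add (hf.const_mul _)
  | @const_mul f c hf h =>
      have : pderiv' n j (fun x => c * f x) = fun x => c * pderiv' n j f x := by
        ext x
        simp only [pderiv']
        rw [fderiv_const_mul (hf.differentiable x)]
        rfl
      rw [this]
      exact h.const_mul c

lemma exp_neg_sq_mul_pow_le {r : ℝ} (hr : 0 ≤ r) (k : ℕ) :
    Real.exp (-r ^ 2 / (4 * 1)) * (1 + r) ^ k ≤ Real.exp 2 * (k.factorial : ℝ) := by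
  have h1 : (1 + r) ^ k ≤ Real.exp (1 + r) * (k.factorial : ℝ) := by
    have := Real.pow_div_factorial_le_exp (1 + r) (by linarith) k
    rwa [div_le_iff₀ (by positivity)] at this
  calc _ ≤ Real.exp (-r ^ 2 / (4 * 1)) * (Real.exp (1 + r) * (k.factorial : ℝ)) := by gcongr
    _ = Real.exp (-r ^ 2 / (4 * 1) + (1 + r)) * (k.factorial : ℝ) := by
        rw [← mul_assoc, ← Real.exp_add]
    _ ≤ _ := by
        gcongr
        nlinarith [sq_nonneg (r - 2)]

lemma GaussPoly.decay {n : ℕ} {f : EuclideanSpace ℝ (Fin n) → ℝ} (hf : GaussPoly n f) (k : ℕ) :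
    ∃ C : ℝ, ∀ x, |f x| * (1 + ‖x‖) ^ k ≤ C := by
  induction hf generalizing k with
  | base =>
      refine ⟨(4 * Real.pi * 1) ^ (-(n : ℝ) / 2) * (Real.exp 2 * (k.factorial : ℝ)), fun x => ?_⟩
      have h0 : 0 ≤ heatKernel n 1 x := by unfold heatKernel; positivity
      rw [abs_of_nonneg h0, heatKernel, mul_assoc]
      exact mul_le_mul_of_nonneg_left (exp_neg_sq_mul_pow_le (norm_nonneg x) k) (by positivity)
  | @add f g _ _ h1 h2 =>
      obtain ⟨C1, hC1⟩ := h1 k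
      obtain ⟨C2, hC2⟩ := h2 k
      refine ⟨C1 + C2, fun x => ?_⟩
      calc _ ≤ (|f x| + |g x|) * (1 + ‖x‖) ^ k := by gcongr; exact abs_add_le _ _
        _ ≤ _ := by rw [add_mul]; exact add_le_add (hC1 x) (hC2 x)
  | @coord f i _ h =>
      obtain ⟨C, hC⟩ := h (k + 1)
      refine ⟨C, fun x => ?_⟩
      have : |x i| ≤ 1 + ‖x‖ := by
        have := PiLp.norm_apply_le x i
        rw [Real.norm_eq_abs] at this
        linarith
      calc |x i * f x| * (1 + ‖x‖) ^ k = |x i| * (|f x| * (1 + ‖x‖) ^ k) := by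
            rw [abs_mul]; ring
        _ ≤ (1 + ‖x‖) * (|f x| * (1 + ‖x‖) ^ k) := by gcongr
        _ = |f x| * (1 + ‖x‖) ^ (k + 1) := by ring
        _ ≤ C := hC x
  | @const_mul f c _ h =>
      obtain ⟨C, hC⟩ := h k
      refine ⟨|c| * C, fun x => ?_⟩
      rw [abs_mul, mul_assoc]
      exact mul_le_mul_of_nonneg_left (hC x) (abs_nonneg c)

lemma GaussPoly.multiDeriv {n : ℕ} {f : EuclideanSpace ℝ (Fin n) → ℝ} (hf : GaussPoly n f)
    (η : Fin n → ℕ) : GaussPoly n (multiDeriv n η f) := by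
  unfold _root_.multiDeriv
  induction List.finRange n with
  | nil => exact hf
  | cons i L ih =>
      rw [List.foldr_cons]
      generalize η i = k
      induction k with
      | zero => exact ih
      | succ k hk =>
          rw [Function.iterate_succ_apply']
          exact hk.pderiv i

lemma exists_multiDeriv_heatKernel_le (n : ℕ) (η : Fin n → ℕ) (M : ℝ) :
    ∃ C : ℝ, 0 < C ∧ ∀ x, |multiDeriv n η (heatKernel n 1) x| ≤ C * (1 + ‖x‖) ^ (-M) := by
  obtain ⟨C, hC⟩ := (GaussPoly.base.multiDeriv η).decay (n := n) ⌈M⌉₊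
  have hC0 : 0 ≤ C := le_trans (by positivity) (hC 0)
  refine ⟨C + 1, by linarith, fun x => ?_⟩
  have h1 : (0 : ℝ) < 1 + ‖x‖ := by positivity
  rw [Real.rpow_neg h1.le, ← div_eq_mul_inv, le_div_iff₀ (by positivity)]
  calc _ ≤ |_root_.multiDeriv n η (heatKernel n 1) x| * (1 + ‖x‖) ^ ⌈M⌉₊ := by
        gcongr
        rw [← Real.rpow_natCast]
        exact Real.rpow_le_rpow_of_exponent_le (by linarith [norm_nonneg x]) (Nat.le_ceil M)
    _ ≤ C + 1 := by linarith [hC x]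

lemma angNorm_comp_smul {n : ℕ} (pt : ℝ≥0∞) (f : EuclideanSpace ℝ (Fin n) → ℝ) (l ρ : ℝ) :
    angNorm n pt (fun x => f (l • x)) ρ = angNorm n pt f (l * ρ) := by
  simp only [angNorm, smul_smul]

lemma mixedNorm_const_mul {n : ℕ} {p : ℝ≥0∞} (h0 : p ≠ 0) (pt : ℝ≥0∞)
    (f : EuclideanSpace ℝ (Fin n) → ℝ) (c : ℝ) :
    mixedNorm n p pt (fun x => c * f x) = ‖c‖ₑ * mixedNorm n p pt f := by
  have h : ∀ ρ, angNorm n pt (fun x => c * f x) ρ = ‖c‖ₑ * angNorm n pt f ρ := fun ρ =>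
    eLpNorm_const_smul c (fun θ : sphere (0 : EuclideanSpace ℝ (Fin n)) 1 =>
      f (ρ • (θ : EuclideanSpace ℝ (Fin n)))) pt (sphereMeasure n)
  simp only [mixedNorm, h]
  split_ifs with ht
  · simp only [ENNReal.mul_iSup]
  · have hp : 0 < p.toReal := ENNReal.toReal_pos h0 ht
    simp only [ENNReal.mul_rpow_of_nonneg _ _ hp.le, mul_assoc]
    rw [lintegral_const_mul' _ _ (ENNReal.rpow_ne_top_of_nonneg hp.le enorm_ne_top),
      ENNReal.mul_rpow_of_nonneg _ _ (by positivity), ← ENNReal.rpow_mul, mul_one_div_cancel hp.ne',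
      ENNReal.rpow_one]

lemma setLIntegral_Ioi_comp_mul_left (G : ℝ → ℝ≥0∞) {l : ℝ} (hl : 0 < l) :
    ∫⁻ ρ in Ioi (0 : ℝ), G (l * ρ) = ENNReal.ofReal l⁻¹ * ∫⁻ ρ in Ioi (0 : ℝ), G ρ := by
  rw [← lintegral_indicator measurableSet_Ioi, ← lintegral_indicator measurableSet_Ioi]
  have h1 := lintegral_map_equiv (μ := volume) ((Ioi (0 : ℝ)).indicator G)
    (Homeomorph.mulLeft₀ l hl.ne').toMeasurableEquiv
  have h2 : Measure.map (Homeomorph.mulLeft₀ l hl.ne').toMeasurableEquiv (volume : Measure ℝ)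
      = ENNReal.ofReal l⁻¹ • volume := by
    have := Real.map_volume_mul_left hl.ne'
    rwa [abs_of_pos (inv_pos.2 hl)] at this
  rw [h2, lintegral_smul_measure, smul_eq_mul] at h1
  rw [h1]
  refine lintegral_congr fun ρ => ?_
  have : (Homeomorph.mulLeft₀ l hl.ne').toMeasurableEquiv ρ = l * ρ := rfl
  rw [this]
  by_cases hρ : 0 < ρ
  · rw [indicator_of_mem (mem_Ioi.2 hρ), indicator_of_mem (mem_Ioi.2 (by positivity))]
  · rw [indicator_of_notMem (by simpa using hρ), indicator_of_notMem]
    simpa [mul_pos_iff_of_pos_left hl] using hρ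

lemma mixedNorm_comp_smul_le {n : ℕ} (hn : 2 ≤ n) {p : ℝ≥0∞} (h0 : p ≠ 0) (pt : ℝ≥0∞)
    (f : EuclideanSpace ℝ (Fin n) → ℝ) {l : ℝ} (hl : 0 < l) :
    mixedNorm n p pt (fun x => f (l • x))
      ≤ ENNReal.ofReal (l ^ (-((n : ℝ) * (p⁻¹).toReal))) * mixedNorm n p pt f := by
  simp only [mixedNorm, angNorm_comp_smul]
  split_ifs with ht
  · subst ht
    simp only [ENNReal.inv_top, ENNReal.toReal_zero, mul_zero, neg_zero, Real.rpow_zero,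
      ENNReal.ofReal_one, one_mul]
    refine iSup₂_le fun ρ hρ => ?_
    exact le_iSup₂ (f := fun ρ (_ : ρ ∈ Ioi (0 : ℝ)) => angNorm n pt f ρ) (l * ρ)
      (mul_pos hl hρ)
  · refine le_of_eq ?_
    have hp : 0 < p.toReal := ENNReal.toReal_pos h0 ht
    have e1 : ∫⁻ ρ in Ioi (0 : ℝ), angNorm n pt f (l * ρ) ^ p.toReal * ENNReal.ofReal (ρ ^ (n - 1))
        = ENNReal.ofReal (l ^ (-(n : ℝ))) *
          ∫⁻ ρ in Ioi (0 : ℝ), angNorm n pt f ρ ^ p.toReal * ENNReal.ofReal (ρ ^ (n - 1)) := by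
      calc _ = ∫⁻ ρ in Ioi (0 : ℝ), ENNReal.ofReal ((l ^ (n - 1))⁻¹) *
              (angNorm n pt f (l * ρ) ^ p.toReal * ENNReal.ofReal ((l * ρ) ^ (n - 1))) := by
            refine setLIntegral_congr_fun measurableSet_Ioi fun ρ hρ => ?_
            rw [mul_left_comm, ← ENNReal.ofReal_mul (by positivity), mul_pow,
              inv_mul_cancel_left₀ (by positivity)]
        _ = ENNReal.ofReal ((l ^ (n - 1))⁻¹) * (ENNReal.ofReal l⁻¹ * _) := by
            rw [lintegral_const_mul' _ _ ENNReal.ofReal_ne_top,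
              setLIntegral_Ioi_comp_mul_left
                (fun ρ => angNorm n pt f ρ ^ p.toReal * ENNReal.ofReal (ρ ^ (n - 1))) hl]
        _ = _ := by
            rw [← mul_assoc, ← ENNReal.ofReal_mul (by positivity)]
            congr 2
            rw [Real.rpow_neg hl.le, Real.rpow_natCast, ← mul_inv, ← pow_succ,
              Nat.sub_add_cancel (by omega)]
    rw [e1, ENNReal.mul_rpow_of_nonneg _ _ (by positivity),
      ENNReal.ofReal_rpow_of_pos (by positivity), ← Real.rpow_mul hl.le]
    congr 3
    rw [ENNReal.toReal_inv]
    ring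

lemma heatKernel_eq_smul (n : ℕ) {s : ℝ} (hs : 0 < s) :
    heatKernel n (s ^ 2) = fun x => s ^ (-(n : ℝ)) * heatKernel n 1 (s⁻¹ • x) := by
  ext x
  have h1 : (4 * Real.pi * s ^ 2) ^ (-(n : ℝ) / 2)
      = s ^ (-(n : ℝ)) * (4 * Real.pi * 1) ^ (-(n : ℝ) / 2) := by
    rw [mul_one, Real.mul_rpow (by positivity) (by positivity), mul_comm, ← Real.rpow_natCast s 2,
      ← Real.rpow_mul hs.le]
    congr 2
    push_cast
    ring
  unfold heatKernel
  rw [h1, mul_assoc, norm_smul, Real.norm_of_nonneg (inv_pos.2 hs).le]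
  congr 3
  field_simp

lemma pderiv_const_mul_comp_smul {n : ℕ} (i : Fin n) (f : EuclideanSpace ℝ (Fin n) → ℝ)
    (c l : ℝ) :
    pderiv' n i (fun x => c * f (l • x)) = fun x => c * l * pderiv' n i f (l • x) := by
  ext x
  simp only [pderiv']
  have h1 : fderiv ℝ (fun x => c * f (l • x)) x = c • fderiv ℝ (fun x => f (l • x)) x :=
    congrFun (fderiv_const_smul_field (𝕜 := ℝ) (f := fun x => f (l • x)) c) x
  rw [h1, fderiv_comp_smul]
  simp [mul_assoc]

lemma multiDeriv_const_mul_comp_smul {n : ℕ} (η : Fin n → ℕ) (f : EuclideanSpace ℝ (Fin n) → ℝ)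
    (c l : ℝ) :
    multiDeriv n η (fun x => c * f (l • x))
      = fun x => c * l ^ (∑ i, η i) * multiDeriv n η f (l • x) := by
  have hk : ∀ (i : Fin n) (k : ℕ) (g : EuclideanSpace ℝ (Fin n) → ℝ) (c : ℝ),
      (pderiv' n i)^[k] (fun x => c * g (l • x))
        = fun x => c * l ^ k * ((pderiv' n i)^[k] g) (l • x) := by
    intro i k g c
    induction k with
    | zero => simp
    | succ k ih =>
        rw [Function.iterate_succ_apply', ih, pderiv_const_mul_comp_smul,
          Function.iterate_succ_apply', pow_succ, mul_assoc c]
  have hL : ∀ L : List (Fin n), L.foldr (fun i g => (pderiv' n i)^[η i] g)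
      (fun x => c * f (l • x)) = fun x => c * l ^ (L.map η).sum *
        (L.foldr (fun i g => (pderiv' n i)^[η i] g) f) (l • x) := by
    intro L
    induction L with
    | nil => simp
    | cons i L ih =>
        rw [List.foldr_cons, ih, hk, List.foldr_cons, List.map_cons,
          List.sum_cons, pow_add]
        ext x
        ring
  rw [multiDeriv, hL, Fin.sum_univ_def]
  rfl

lemma conv_multiDeriv_heatKernel {n : ℕ} (η : Fin n → ℕ) (u : EuclideanSpace ℝ (Fin n) → ℝ)
    {s : ℝ} (hs : 0 < s) (x : EuclideanSpace ℝ (Fin n)) :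
    conv n (multiDeriv n η (heatKernel n (s ^ 2))) u x
      = s⁻¹ ^ (∑ i, η i) *
        conv n (multiDeriv n η (heatKernel n 1)) (fun y => u (s • y)) (s⁻¹ • x) := by
  rw [heatKernel_eq_smul n hs, multiDeriv_const_mul_comp_smul]
  unfold conv
  have h := Measure.integral_comp_smul volume
    (fun y => multiDeriv n η (heatKernel n 1) (s⁻¹ • (x - y)) * u y) s
  rw [finrank_euclideanSpace_fin, smul_eq_mul, abs_of_pos (by positivity)] at h
  have h2 : ∀ y : EuclideanSpace ℝ (Fin n), s⁻¹ • (x - s • y) = s⁻¹ • x - y := fun y => by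
    rw [smul_sub, smul_smul, inv_mul_cancel₀ hs.ne', one_smul]
  simp only [h2] at h
  rw [h]
  simp only [mul_assoc]
  rw [integral_const_mul, integral_const_mul, Real.rpow_neg hs.le, Real.rpow_natCast]
  ring

lemma norm_rpow_comp_smul {n : ℕ} {s : ℝ} (hs : 0 < s) (x : EuclideanSpace ℝ (Fin n)) (γ : ℝ) :
    ‖x‖ ^ γ = s ^ (-γ) * ‖s • x‖ ^ γ := by
  rw [norm_smul, Real.norm_of_nonneg hs.le, Real.mul_rpow hs.le (norm_nonneg x), ← mul_assoc,
    ← Real.rpow_add hs, neg_add_cancel, Real.rpow_zero, one_mul]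

lemma enorm_conv_le {n : ℕ} {K u : EuclideanSpace ℝ (Fin n) → ℝ} {D M : ℝ} (hD : 0 < D)
    (hK : ∀ x, |K x| ≤ D * (1 + ‖x‖) ^ (-M)) (x : EuclideanSpace ℝ (Fin n)) :
    ‖conv n K u x‖ₑ ≤ ∫⁻ y, ENNReal.ofReal ((1 + ‖x - y‖) ^ (-M)) * ‖D * u y‖ₑ := by
  refine (enorm_integral_le_lintegral_enorm _).trans (lintegral_mono fun y => ?_)
  dsimp only
  rw [enorm_mul, enorm_mul, Real.enorm_of_nonneg hD.le, ← mul_assoc,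
    ← ENNReal.ofReal_mul (by positivity), mul_comm _ D, Real.enorm_eq_ofReal_abs (K (x - y))]
  exact mul_le_mul' (ENNReal.ofReal_le_ofReal (hK _)) le_rfl

/-- time decay for the heat kernel in weighted mixed radial-angular spaces. -/
theorem stmt1 (n : ℕ) (hn : 2 ≤ n) (p q pt qt : ℝ≥0∞)
    (hp : 1 ≤ p) (hpq : p ≤ q) (hpt : 1 ≤ pt) (hptqt : pt ≤ qt)
    (α β : ℝ)
    (hβ : -((n : ℝ) * (q⁻¹).toReal) < β)
    (hα : α < (n : ℝ) * (1 - (p⁻¹).toReal))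
    (hΛ : β + ((n : ℝ) - 1) * (q⁻¹).toReal - ((n : ℝ) - 1) * (qt⁻¹).toReal
        ≤ α + ((n : ℝ) - 1) * (p⁻¹).toReal - ((n : ℝ) - 1) * (pt⁻¹).toReal)
    (η : Fin n → ℕ)
    (hη : 0 ≤ (∑ i, (η i : ℝ)) + (n : ℝ) * (p⁻¹).toReal - (n : ℝ) * (q⁻¹).toReal + α - β) :
    ∃ c : ℝ, 0 < c ∧ ∀ t : ℝ, 0 < t → ∀ u₀ : EuclideanSpace ℝ (Fin n) → ℝ, Measurable u₀ →
      mixedNorm n q qt (fun x => ‖x‖ ^ β * conv n (multiDeriv n η (heatKernel n t)) u₀ x)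
        ≤ ENNReal.ofReal (c * t ^ (-(((∑ i, (η i : ℝ)) + (n : ℝ) * (p⁻¹).toReal
            - (n : ℝ) * (q⁻¹).toReal + α - β) / 2)))
          * mixedNorm n p pt (fun x => ‖x‖ ^ α * u₀ x) := by
  have hp0 : p ≠ 0 := (zero_lt_one.trans_le hp).ne'
  have hq0 : q ≠ 0 := (zero_lt_one.trans_le (hp.trans hpq)).ne'
  obtain ⟨M, C, hC, core⟩ := exists_mixedNorm_bound hn hp hpq hpt hptqt hβ hα hΛ
  obtain ⟨D, hD, hK⟩ := exists_multiDeriv_heatKernel_le n η M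
  refine ⟨C.toReal * D + 1, by positivity, fun t ht u hu => ?_⟩
  obtain ⟨s, hs, rfl⟩ : ∃ s : ℝ, 0 < s ∧ t = s ^ 2 :=
    ⟨√t, Real.sqrt_pos.2 ht, (Real.sq_sqrt ht.le).symm⟩
  set k := ∑ i, η i with hk
  set V := fun x : EuclideanSpace ℝ (Fin n) => ‖x‖ ^ α * u x with hV
  set h := conv n (multiDeriv n η (heatKernel n 1)) (fun y => u (s • y)) with hh
  set W := fun x : EuclideanSpace ℝ (Fin n) => ‖x‖ ^ β * h x with hW
  have hs' : 0 < s⁻¹ := inv_pos.2 hs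
  have hL : (fun x => ‖x‖ ^ β * conv n (multiDeriv n η (heatKernel n (s ^ 2))) u x)
      = fun x => (s⁻¹ ^ k * s ^ β) * W (s⁻¹ • x) := by
    ext x
    rw [conv_multiDeriv_heatKernel η u hs, hW, norm_rpow_comp_smul hs' x, Real.inv_rpow hs.le,
      Real.rpow_neg hs.le, inv_inv]
    ring
  have hR : (fun x : EuclideanSpace ℝ (Fin n) => ‖x‖ ^ α * (D * u (s • x)))
      = fun x => (D * s ^ (-α)) * V (s • x) := by
    ext x
    rw [hV, norm_rpow_comp_smul hs x]
    ring
  have hWV : mixedNorm n q qt W ≤ C * (ENNReal.ofReal (D * s ^ (-α)) *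
      (ENNReal.ofReal (s ^ (-((n : ℝ) * (p⁻¹).toReal))) * mixedNorm n p pt V)) := by
    have := core h (fun y => D * u (s • y)) (by fun_prop) (enorm_conv_le hD hK)
    rw [hR, mixedNorm_const_mul hp0, Real.enorm_of_nonneg (by positivity)] at this
    exact this.trans (mul_le_mul' le_rfl
      (mul_le_mul' le_rfl (mixedNorm_comp_smul_le hn hp0 pt V hs)))
  have hpow : s⁻¹ ^ k * s ^ β * s⁻¹ ^ (-((n : ℝ) * (q⁻¹).toReal)) *
      (C.toReal * (D * s ^ (-α) * s ^ (-((n : ℝ) * (p⁻¹).toReal))))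
      = C.toReal * D * (s ^ 2) ^ (-(((∑ i, (η i : ℝ)) + (n : ℝ) * (p⁻¹).toReal
            - (n : ℝ) * (q⁻¹).toReal + α - β) / 2)) := by
    have e1 : s⁻¹ ^ k = s ^ (-(∑ i, (η i : ℝ))) := by
      rw [Real.rpow_neg hs.le, inv_pow, hk, ← Nat.cast_sum, Real.rpow_natCast]
    have e2 : (s ^ 2) ^ (-(((∑ i, (η i : ℝ)) + (n : ℝ) * (p⁻¹).toReal
            - (n : ℝ) * (q⁻¹).toReal + α - β) / 2))
        = s ^ (-(∑ i, (η i : ℝ)) + β + (n : ℝ) * (q⁻¹).toReal + -α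
          + -((n : ℝ) * (p⁻¹).toReal)) := by
      rw [← Real.rpow_natCast, ← Real.rpow_mul hs.le]
      congr 1
      push_cast
      ring
    rw [e1, e2, Real.inv_rpow hs.le, ← Real.rpow_neg hs.le, neg_neg, Real.rpow_add hs,
      Real.rpow_add hs, Real.rpow_add hs, Real.rpow_add hs]
    ring
  rw [hL, mixedNorm_const_mul hq0, Real.enorm_of_nonneg (by positivity)]
  calc _ ≤ ENNReal.ofReal (s⁻¹ ^ k * s ^ β) *
        (ENNReal.ofReal (s⁻¹ ^ (-((n : ℝ) * (q⁻¹).toReal))) *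
        (C * (ENNReal.ofReal (D * s ^ (-α)) *
      (ENNReal.ofReal (s ^ (-((n : ℝ) * (p⁻¹).toReal))) * mixedNorm n p pt V)))) :=
        mul_le_mul' le_rfl ((mixedNorm_comp_smul_le hn hq0 qt W hs').trans
          (mul_le_mul' le_rfl hWV))
    _ = ENNReal.ofReal (C.toReal * D * (s ^ 2) ^ (-(((∑ i, (η i : ℝ)) + (n : ℝ) * (p⁻¹).toReal
            - (n : ℝ) * (q⁻¹).toReal + α - β) / 2))) * mixedNorm n p pt V := by
        rw [← hpow,
          ENNReal.ofReal_mul (p := s⁻¹ ^ k * s ^ β * s⁻¹ ^ (-((n : ℝ) * (q⁻¹).toReal)))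
            (by positivity),
          ENNReal.ofReal_mul (p := s⁻¹ ^ k * s ^ β) (by positivity),
          ENNReal.ofReal_mul (p := C.toReal) ENNReal.toReal_nonneg,
          ENNReal.ofReal_mul (p := D * s ^ (-α)) (by positivity), ENNReal.ofReal_toReal hC]
        ring
    _ ≤ _ := by
        refine mul_le_mul' (ENNReal.ofReal_le_ofReal ?_) le_rfl
        gcongr
        linarith
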